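/- arXiv:1811.11904 — 3 statements merged into one kernel-verified Lean document; each statement's English description precedes it below -/
import Mathlib

section
/- Let u : ℝ → ℝ be continuous and 2π-periodic, μ > 0, and let f : ℝ → ℂ be twice continuously differentiable, 2π-periodic, satisfying −f''(y) + i u(y) f(y) = μ \overline{f(y)} for all y, with sup_y |f(y)| = 1 and |f(y₀)| = 1 for some y₀ ∈ ℝ. Then for every y with |y − y₀| < π/(2√μ) one has |Re( f'(y) \overline{f(y)} )| ≤ √μ tan(√μ |y − y₀|) · |f(y)|². -/
/-- Energy estimate at a point of increase: if `2NN'' - N'² + 4μN² ≥ 0` and `0 ≤ N ≤ 1` is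
periodic, then `N'²/(4N) + μN` increases up to the next critical point, where it is at most `μ`. -/
lemma sq_deriv_le_of_deriv_pos {N P Q : ℝ → ℝ} {μ T : ℝ} (hμ : 0 < μ) (hT : 0 < T)
    (hN : ∀ y, HasDerivAt N (P y) y) (hP : ∀ y, HasDerivAt P (Q y) y)
    (hper : Function.Periodic N T) (h0 : ∀ y, 0 ≤ N y) (h1 : ∀ y, N y ≤ 1)
    (hQ : ∀ y, 0 ≤ 2 * N y * Q y - P y ^ 2 + 4 * μ * N y ^ 2) {a : ℝ} (ha : 0 < P a) :
    P a ^ 2 ≤ 4 * μ * (N a * (1 - N a)) := by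
  have hPc : Continuous P := continuous_iff_continuousAt.2 fun y => (hP y).continuousAt
  have hNc : Continuous N := continuous_iff_continuousAt.2 fun y => (hN y).continuousAt
  have hNa : 0 < N a := by
    refine (h0 a).lt_of_ne fun h => ?_
    have := hQ a
    rw [← h] at this
    nlinarith [pow_pos ha 2]
  obtain ⟨b, ⟨hab, hb⟩, hmin⟩ : ∃ b, IsLeast {z | a ≤ z ∧ P z = 0} b := by
    have hclosed : IsClosed {z | a ≤ z ∧ P z = 0} :=
      (isClosed_le continuous_const continuous_id).inter (isClosed_eq hPc continuous_const)
    obtain ⟨c, hc, hc0⟩ := exists_hasDerivAt_eq_zero (a := a) (b := a + T) (by linarith)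
      hNc.continuousOn (hper a).symm (fun x _ => hN x)
    exact ⟨_, hclosed.isLeast_csInf ⟨c, hc.1.le, hc0⟩ ⟨a, fun z hz => hz.1⟩⟩
  have hpos : ∀ z ∈ Set.Ico a b, 0 < P z := by
    intro z hz
    by_contra! h
    obtain ⟨w, hw, hw0⟩ := intermediate_value_Icc' hz.1 hPc.continuousOn ⟨h, ha.le⟩
    have := hmin ⟨hw.1, hw0⟩
    linarith [hw.2, hz.2]
  have hnonneg : ∀ z ∈ Set.Icc a b, 0 ≤ P z := by
    intro z hz
    rcases hz.2.eq_or_lt with h | h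
    · rw [h, hb]
    · exact (hpos z ⟨hz.1, h⟩).le
  have hNmono : MonotoneOn N (Set.Icc a b) := by
    refine monotoneOn_of_deriv_nonneg (convex_Icc a b) hNc.continuousOn
      (fun x _ => (hN x).differentiableAt.differentiableWithinAt) fun x hx => ?_
    rw [(hN x).deriv]
    exact hnonneg x (interior_subset hx)
  have hNpos : ∀ z ∈ Set.Icc a b, 0 < N z := fun z hz =>
    hNa.trans_le (hNmono (Set.left_mem_Icc.2 hab) hz hz.1)
  have hE : ∀ z ∈ Set.Icc a b, HasDerivAt (fun y => P y ^ 2 / (4 * N y) + μ * N y)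
      (P z * (2 * N z * Q z - P z ^ 2 + 4 * μ * N z ^ 2) / (4 * N z ^ 2)) z := by
    intro z hz
    have hz0 := hNpos z hz
    refine ((((hP z).pow 2).div ((hN z).const_mul 4) (by positivity)).add
      ((hN z).const_mul μ)).congr_deriv ?_
    simp only [Pi.pow_apply]
    field_simp
    ring
  have hEmono : MonotoneOn (fun y => P y ^ 2 / (4 * N y) + μ * N y) (Set.Icc a b) := by
    refine monotoneOn_of_deriv_nonneg (convex_Icc a b)
      (fun x hx => (hE x hx).continuousAt.continuousWithinAt)
      (fun x hx => (hE x (interior_subset hx)).differentiableAt.differentiableWithinAt)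
      fun x hx => ?_
    have hx := interior_subset hx
    rw [(hE x hx).deriv]
    exact div_nonneg (mul_nonneg (hnonneg x hx) (hQ x)) (by positivity)
  have hle := hEmono (Set.left_mem_Icc.2 hab) (Set.right_mem_Icc.2 hab) hab
  simp only [hb] at hle
  have hle' : P a ^ 2 / (4 * N a) ≤ μ * (1 - N a) := by
    have := mul_le_mul_of_nonneg_left (h1 b) hμ.le
    norm_num at hle
    linarith
  rw [div_le_iff₀ (by positivity)] at hle'
  linarith

/-- The energy estimate of `sq_deriv_le_of_deriv_pos` at an arbitrary point. -/
lemma sq_deriv_le_of_periodic {N P Q : ℝ → ℝ} {μ T : ℝ} (hμ : 0 < μ) (hT : 0 < T)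
    (hN : ∀ y, HasDerivAt N (P y) y) (hP : ∀ y, HasDerivAt P (Q y) y)
    (hper : Function.Periodic N T) (h0 : ∀ y, 0 ≤ N y) (h1 : ∀ y, N y ≤ 1)
    (hQ : ∀ y, 0 ≤ 2 * N y * Q y - P y ^ 2 + 4 * μ * N y ^ 2) (a : ℝ) :
    P a ^ 2 ≤ 4 * μ * (N a * (1 - N a)) := by
  rcases lt_trichotomy (P a) 0 with h | h | h
  · have hN' : ∀ y, HasDerivAt (fun y => N (-y)) (-P (-y)) y := fun y => by
      exact ((hN (-y)).comp y (hasDerivAt_neg y)).congr_deriv (by ring)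
    have hP' : ∀ y, HasDerivAt (fun y => -P (-y)) (Q (-y)) y := fun y => by
      exact ((hP (-y)).comp y (hasDerivAt_neg y)).neg.congr_deriv (by ring)
    have := sq_deriv_le_of_deriv_pos hμ hT hN' hP'
      (fun y => by simp only; rw [neg_add, ← sub_eq_add_neg, hper.sub_eq])
      (fun y => h0 _) (fun y => h1 _) (fun y => by simpa using hQ (-y)) (a := -a) (by simpa using h)
    simpa using this
  · rw [h, zero_pow two_ne_zero]
    exact mul_nonneg (by positivity) (mul_nonneg (h0 a) (sub_nonneg.2 (h1 a)))
  · exact sq_deriv_le_of_deriv_pos hμ hT hN hP hper h0 h1 hQ h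

/-- If `|M| ≤ 1`, `M'² ≤ k²(1 - M²)` and `M x₀ = 1`, then `M x ≥ cos (k|x - x₀|)` as long as
`k|x - x₀| ≤ π`. -/
lemma cos_le_of_sq_deriv_le {M M' : ℝ → ℝ} {k : ℝ} (hk : 0 ≤ k)
    (hM : ∀ y, HasDerivAt M (M' y) y) (hle : ∀ y, M y ^ 2 ≤ 1)
    (hd : ∀ y, M' y ^ 2 ≤ k ^ 2 * (1 - M y ^ 2)) {x₀ x : ℝ} (hx₀ : M x₀ = 1)
    (hx : k * |x - x₀| ≤ Real.pi) : Real.cos (k * |x - x₀|) ≤ M x := by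
  have key : ∀ c ∈ Set.Ioo (0 : ℝ) 1,
      Real.arccos (c * M x) ≤ Real.arccos c + k * |x - x₀| := by
    intro c hc
    have hlt : ∀ y, (c * M y) ^ 2 < 1 := fun y => by
      have : c ^ 2 < 1 := by nlinarith [hc.1, hc.2]
      nlinarith [hle y, sq_nonneg (M y), sq_nonneg c]
    have hder : ∀ y, HasDerivAt (fun y => Real.arccos (c * M y))
        (-(1 / √(1 - (c * M y) ^ 2)) * (c * M' y)) y := fun y =>
      (Real.hasDerivAt_arccos (fun h => by have := hlt y; rw [h] at this; norm_num at this)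
        (fun h => by have := hlt y; rw [h] at this; norm_num at this)).comp y
        ((hM y).const_mul c)
    have hbound : ∀ y, ‖-(1 / √(1 - (c * M y) ^ 2)) * (c * M' y)‖ ≤ k := by
      intro y
      have hs : 0 < √(1 - (c * M y) ^ 2) := Real.sqrt_pos.2 (by linarith [hlt y])
      rw [norm_mul, norm_neg, Real.norm_eq_abs, Real.norm_eq_abs, abs_of_pos (by positivity),
        one_div, inv_mul_le_iff₀ hs]
      refine abs_le_of_sq_le_sq ?_ (mul_nonneg hs.le hk)
      rw [mul_pow, mul_pow, Real.sq_sqrt (by linarith [hlt y])]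
      have hc2 : c ^ 2 ≤ 1 := by nlinarith [hc.1, hc.2]
      nlinarith [mul_le_mul_of_nonneg_left (hd y) (sq_nonneg c),
        mul_nonneg (sub_nonneg.2 hc2) (sq_nonneg k)]
    have := convex_univ.norm_image_sub_le_of_norm_hasDerivWithin_le
      (fun y _ => (hder y).hasDerivWithinAt) (fun y _ => hbound y)
      (Set.mem_univ x₀) (Set.mem_univ x)
    rw [hx₀, mul_one, Real.norm_eq_abs, Real.norm_eq_abs] at this
    linarith [le_abs_self (Real.arccos (c * M x) - Real.arccos c)]
  have hlim : Real.arccos (1 * M x) ≤ Real.arccos 1 + k * |x - x₀| := by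
    have hmem : (1 : ℝ) ∈ closure (Set.Ioo (0 : ℝ) 1) := by
      rw [closure_Ioo zero_ne_one]
      exact ⟨zero_le_one, le_rfl⟩
    refine le_on_closure key ?_ ?_ hmem
    · exact (Real.continuous_arccos.comp (continuous_mul_const (M x))).continuousOn
    · exact (Real.continuous_arccos.add continuous_const).continuousOn
  rw [one_mul, Real.arccos_one, zero_add] at hlim
  have hM1 := abs_le.1 ((sq_le_one_iff_abs_le_one _).1 (hle x))
  rw [← Real.cos_arccos hM1.1 hM1.2]
  exact Real.cos_le_cos_of_nonneg_of_le_pi (Real.arccos_nonneg _) hx hlim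


/-- Pointwise bound on `ρ' = Re(f' f̄)/|f|²` near a maximum point: if
`-f'' + iuf = μ f̄` with `μ > 0`, `sup |f| = 1` and `|f(y₀)| = 1`, then
`|Re(f'(y) f̄(y))| ≤ √μ tan(√μ |y - y₀|) |f(y)|²` for `|y - y₀| < π/(2√μ)`. -/
theorem stmt_9 (u : ℝ → ℝ) (hu : Continuous u) (huper : Function.Periodic u (2 * Real.pi))
    (μ : ℝ) (hμ : 0 < μ)
    (f : ℝ → ℂ) (hf : ContDiff ℝ 2 f) (hfper : Function.Periodic f (2 * Real.pi))
    (heq : ∀ y, -(deriv (deriv f)) y + Complex.I * (u y : ℂ) * f y =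
      (μ : ℂ) * (starRingEnd ℂ) (f y))
    (hsup : ∀ y, ‖f y‖ ≤ 1) (y₀ : ℝ) (hy₀ : ‖f y₀‖ = 1) :
    ∀ y : ℝ, |y - y₀| < Real.pi / (2 * Real.sqrt μ) →
      |(deriv f y * (starRingEnd ℂ) (f y)).re| ≤
        Real.sqrt μ * Real.tan (Real.sqrt μ * |y - y₀|) * ‖f y‖ ^ 2 := by
  have hs : 0 < √μ := Real.sqrt_pos.2 hμ
  have hs2 : √μ ^ 2 = μ := Real.sq_sqrt hμ.le
  have hf1 : ∀ y, HasDerivAt f (deriv f y) y := fun y =>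
    (hf.differentiable (by norm_num) y).hasDerivAt
  have hf2 : ∀ y, HasDerivAt (deriv f) (deriv (deriv f) y) y := fun y =>
    (((contDiff_succ_iff_deriv (n := 1)).1 hf).2.2.differentiable (by norm_num) y).hasDerivAt
  have hre : ∀ {g : ℝ → ℂ} {g' : ℂ} {y : ℝ}, HasDerivAt g g' y →
      HasDerivAt (fun x => (g x).re) g'.re y := fun h =>
    Complex.reCLM.hasFDerivAt.comp_hasDerivAt _ h
  have him : ∀ {g : ℝ → ℂ} {g' : ℂ} {y : ℝ}, HasDerivAt g g' y →
      HasDerivAt (fun x => (g x).im) g'.im y := fun h =>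
    Complex.imCLM.hasFDerivAt.comp_hasDerivAt _ h
  have hnorm : ∀ y, ‖f y‖ ^ 2 = (f y).re ^ 2 + (f y).im ^ 2 := fun y => by
    rw [← Complex.normSq_eq_norm_sq, Complex.normSq_apply]; ring
  have hP : ∀ y, (deriv f y * (starRingEnd ℂ) (f y)).re =
      (deriv f y).re * (f y).re + (deriv f y).im * (f y).im := fun y => by
    simp [Complex.mul_re]
  have hder1 : ∀ y, HasDerivAt (fun y => ‖f y‖ ^ 2)
      (2 * (deriv f y * (starRingEnd ℂ) (f y)).re) y := fun y => by
    simp only [hnorm, hP]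
    refine (((hre (hf1 y)).pow 2).add ((him (hf1 y)).pow 2)).congr_deriv ?_
    push_cast
    ring
  have hder2 : ∀ y, HasDerivAt (fun y => 2 * (deriv f y * (starRingEnd ℂ) (f y)).re)
      (2 * ((deriv f y).re ^ 2 + (deriv f y).im ^ 2
        - μ * ((f y).re ^ 2 - (f y).im ^ 2))) y := fun y => by
    simp only [hP]
    have h1 := congrArg Complex.re (heq y)
    have h2 := congrArg Complex.im (heq y)
    simp at h1 h2
    refine ((((hre (hf2 y)).mul (hre (hf1 y))).add
      ((him (hf2 y)).mul (him (hf1 y)))).const_mul 2).congr_deriv ?_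
    linear_combination (-2 * (f y).re) * h1 - 2 * (f y).im * h2
  have h1 : ∀ y, ‖f y‖ ^ 2 ≤ 1 := fun y => pow_le_one₀ (norm_nonneg _) (hsup y)
  have henergy := sq_deriv_le_of_periodic hμ Real.two_pi_pos hder1 hder2
    (fun y => by simp only [hfper y]) (fun y => sq_nonneg _) h1 (fun y => by
      rw [hP, hnorm]
      nlinarith [sq_nonneg ((deriv f y).re * (f y).im - (deriv f y).im * (f y).re),
        mul_nonneg hμ.le (mul_nonneg (add_nonneg (sq_nonneg (f y).re) (sq_nonneg (f y).im))
          (sq_nonneg (f y).im))])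
  intro y hy
  have hst : √μ * |y - y₀| < Real.pi / 2 := by
    rw [lt_div_iff₀ (by positivity)] at hy ⊢
    linarith
  have hst0 : 0 ≤ √μ * |y - y₀| := by positivity
  have hcos := cos_le_of_sq_deriv_le (M := fun y => 2 * ‖f y‖ ^ 2 - 1) (k := 2 * √μ)
    (by positivity) (fun y => ((hder1 y).const_mul 2).sub_const 1)
    (fun y => by nlinarith [h1 y, sq_nonneg ‖f y‖])
    (fun y => by rw [mul_pow 2 (√μ), hs2]; linarith [henergy y])
    (x₀ := y₀) (x := y) (by rw [hy₀]; norm_num) (by linarith)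
  rw [mul_assoc, Real.cos_two_mul] at hcos
  have hE := henergy y
  generalize √μ * |y - y₀| = t at *
  have hc : 0 < Real.cos t := Real.cos_pos_of_mem_Ioo ⟨by linarith [Real.pi_pos], hst⟩
  have hsin : 0 ≤ Real.sin t := Real.sin_nonneg_of_nonneg_of_le_pi hst0 (by linarith [Real.pi_pos])
  have hN0 : 0 ≤ ‖f y‖ ^ 2 := sq_nonneg _
  rw [Real.tan_eq_sin_div_cos]
  refine abs_le_of_sq_le_sq ?_ (by positivity)
  rw [mul_pow, mul_pow, hs2, div_pow]
  have hmul : ‖f y‖ ^ 2 * (1 - ‖f y‖ ^ 2) ≤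
      Real.sin t ^ 2 / Real.cos t ^ 2 * (‖f y‖ ^ 2) ^ 2 := by
    rw [div_mul_eq_mul_div, le_div_iff₀ (by positivity), Real.sin_sq]
    nlinarith
  have := mul_le_mul_of_nonneg_left hmul hμ.le
  linarith
end

section
/- Let u : ℝ → ℝ be continuous and 2π-periodic, μ > 0, and let f : ℝ → ℂ be twice continuously differentiable, 2π-periodic, satisfying −f''(y) + i u(y) f(y) = μ \overline{f(y)} for all y, with sup_y |f(y)| = 1 and |f(y₀)| = 1 for some y₀ ∈ ℝ. Then for every δ with 0 < δ < π/(2√μ), ∫_{y₀−δ}^{y₀+δ} ( Im( f'(y) \overline{f(y)} ) )² / |f(y)|⁴ dy ≤ 4 √μ tan(√μ δ). -/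
open Set Real

/-- Sturm comparison for `r'' + k² r ≥ 0`: the Wronskian with `cos (k (z - m))` is monotone on
intervals where the cosine is nonnegative. -/
lemma monotoneOn_wronskian_cos {r r₁ r₂ : ℝ → ℝ} {k m a b : ℝ}
    (hr : ∀ x, HasDerivAt r (r₁ x) x) (hr₁ : ∀ x, HasDerivAt r₁ (r₂ x) x)
    (hr₂ : ∀ x, 0 ≤ r₂ x + k ^ 2 * r x) (hc : ∀ x ∈ Icc a b, 0 ≤ cos (k * (x - m))) :
    MonotoneOn (fun z => r₁ z * cos (k * (z - m)) + k * r z * sin (k * (z - m))) (Icc a b) := by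
  have hd : ∀ z, HasDerivAt
      (fun z => r₁ z * cos (k * (z - m)) + k * r z * sin (k * (z - m)))
      ((r₂ z + k ^ 2 * r z) * cos (k * (z - m))) z := by
    intro z
    have h0 : HasDerivAt (fun z => k * (z - m)) k z := by
      simpa using ((hasDerivAt_id z).sub_const m).const_mul k
    refine (((hr₁ z).mul h0.cos).add (((hr z).const_mul k).mul h0.sin)).congr_deriv ?_
    ring
  refine monotoneOn_of_hasDerivWithinAt_nonneg (convex_Icc a b)
    (fun z _ => (hd z).continuousAt.continuousWithinAt)
    (fun z _ => (hd z).hasDerivWithinAt) fun z hz => ?_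
  exact mul_nonneg (hr₂ z) (hc z (interior_subset hz))

/-- The derivative of `r / cos (k (z - m))`. -/
lemma hasDerivAt_div_cos {r : ℝ → ℝ} {r' k m z : ℝ} (hr : HasDerivAt r r' z)
    (hc : 0 < cos (k * (z - m))) :
    HasDerivAt (fun z => r z / cos (k * (z - m)))
      ((r' * cos (k * (z - m)) + k * r z * sin (k * (z - m))) / cos (k * (z - m)) ^ 2) z := by
  have h0 : HasDerivAt (fun z => k * (z - m)) k z := by
    simpa using ((hasDerivAt_id z).sub_const m).const_mul k
  refine (hr.div h0.cos hc.ne').congr_deriv ?_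
  ring

/-- To the right of a maximum point, a solution of `r'' + k² r ≥ 0` stays above the cosine and
its derivative obeys a two-sided tangent bound. -/
lemma bounds_right_of_max {r r₁ r₂ : ℝ → ℝ} {k y₀ t : ℝ} (hk : 0 < k)
    (hr : ∀ x, HasDerivAt r (r₁ x) x) (hr₁ : ∀ x, HasDerivAt r₁ (r₂ x) x)
    (hr₂ : ∀ x, 0 ≤ r₂ x + k ^ 2 * r x) (hmax : ∀ x, r x ≤ r y₀)
    (ht : 0 ≤ t) (hkt : k * t < π / 2) :
    r y₀ * cos (k * t) ≤ r (y₀ + t) ∧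
      |r₁ (y₀ + t)| * cos (k * t) ≤ k * r (y₀ + t) * sin (k * t) := by
  have h0 : r₁ y₀ = 0 :=
    IsLocalMax.hasDerivAt_eq_zero (Filter.Eventually.of_forall hmax) (hr y₀)
  have hkt0 : 0 ≤ k * t := by positivity
  have hpi := pi_pos
  have hct : 0 < cos (k * t) := cos_pos_of_mem_Ioo ⟨by linarith, hkt⟩
  have hc : ∀ x ∈ Icc y₀ (y₀ + t), 0 < cos (k * (x - y₀)) := fun x hx =>
    cos_pos_of_mem_Ioo ⟨by nlinarith [hx.1], by nlinarith [hx.2]⟩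
  have hW := monotoneOn_wronskian_cos (m := y₀) hr hr₁ hr₂ fun x hx => (hc x hx).le
  have hW0 : ∀ x ∈ Icc y₀ (y₀ + t),
      0 ≤ r₁ x * cos (k * (x - y₀)) + k * r x * sin (k * (x - y₀)) := fun x hx => by
    simpa [h0] using hW (left_mem_Icc.2 (by linarith)) hx hx.1
  have hlow : r y₀ * cos (k * t) ≤ r (y₀ + t) := by
    have hq : MonotoneOn (fun z => r z / cos (k * (z - y₀))) (Icc y₀ (y₀ + t)) :=
      monotoneOn_of_hasDerivWithinAt_nonneg (convex_Icc _ _)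
        (fun z hz => (hasDerivAt_div_cos (hr z) (hc z hz)).continuousAt.continuousWithinAt)
        (fun z hz => (hasDerivAt_div_cos (hr z) (hc z (interior_subset hz))).hasDerivWithinAt)
        (fun z hz => div_nonneg (hW0 z (interior_subset hz)) (sq_nonneg _))
    have := hq (left_mem_Icc.2 (by linarith)) (right_mem_Icc.2 (by linarith))
      (by linarith : y₀ ≤ y₀ + t)
    simp only [sub_self, mul_zero, cos_zero, div_one, add_sub_cancel_left] at this
    rwa [le_div_iff₀ hct] at this
  refine ⟨hlow, ?_⟩
  have h1 := hW0 (y₀ + t) (right_mem_Icc.2 (by linarith))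
  rw [add_sub_cancel_left] at h1
  have h2 : r₁ (y₀ + t) * cos (k * t) ≤ k * r (y₀ + t) * sin (k * t) := by
    by_contra! hcon
    have htpos : 0 < t := by
      rcases ht.eq_or_lt with rfl | h
      · simp [h0] at hcon
      · exact h
    have hc' : ∀ x ∈ Icc (y₀ + t) (y₀ + t + t), 0 < cos (k * (x - (y₀ + t + t))) := fun x hx =>
      cos_pos_of_mem_Ioo ⟨by nlinarith [hx.1], by nlinarith [hx.2]⟩
    have hV := monotoneOn_wronskian_cos (m := y₀ + t + t) hr hr₁ hr₂ fun x hx => (hc' x hx).le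
    have harg : k * (y₀ + t - (y₀ + t + t)) = -(k * t) := by ring
    have hV0 : ∀ x ∈ Icc (y₀ + t) (y₀ + t + t),
        0 < r₁ x * cos (k * (x - (y₀ + t + t))) + k * r x * sin (k * (x - (y₀ + t + t))) := by
      intro x hx
      have := hV (left_mem_Icc.2 (by linarith)) hx hx.1
      simp only [harg, cos_neg, sin_neg] at this
      linarith
    have hq : StrictMonoOn (fun z => r z / cos (k * (z - (y₀ + t + t))))
        (Icc (y₀ + t) (y₀ + t + t)) :=
      strictMonoOn_of_hasDerivWithinAt_pos (convex_Icc _ _)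
        (fun z hz => (hasDerivAt_div_cos (hr z) (hc' z hz)).continuousAt.continuousWithinAt)
        (fun z hz => (hasDerivAt_div_cos (hr z) (hc' z (interior_subset hz))).hasDerivWithinAt)
        (fun z hz => div_pos (hV0 z (interior_subset hz))
          (pow_pos (hc' z (interior_subset hz)) 2))
    have := hq (left_mem_Icc.2 (by linarith)) (right_mem_Icc.2 (by linarith))
      (by linarith : y₀ + t < y₀ + t + t)
    simp only [harg, cos_neg, sub_self, mul_zero, cos_zero, div_one] at this
    rw [div_lt_iff₀ hct] at this
    nlinarith [hmax (y₀ + t + t)]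
  rcases abs_cases (r₁ (y₀ + t)) with h | h <;> rw [h.1] <;> linarith

/-- Two-sided version of `bounds_right_of_max`. -/
lemma bounds_near_max {r r₁ r₂ : ℝ → ℝ} {k y₀ t : ℝ} (hk : 0 < k)
    (hr : ∀ x, HasDerivAt r (r₁ x) x) (hr₁ : ∀ x, HasDerivAt r₁ (r₂ x) x)
    (hr₂ : ∀ x, 0 ≤ r₂ x + k ^ 2 * r x) (hmax : ∀ x, r x ≤ r y₀) (hkt : k * |t| < π / 2) :
    r y₀ * cos (k * |t|) ≤ r (y₀ + t) ∧
      |r₁ (y₀ + t)| * cos (k * |t|) ≤ k * r (y₀ + t) * sin (k * |t|) := by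
  rcases le_total 0 t with ht | ht
  · rw [abs_of_nonneg ht] at hkt ⊢
    exact bounds_right_of_max hk hr hr₁ hr₂ hmax ht hkt
  · rw [abs_of_nonpos ht] at hkt ⊢
    have hs : ∀ x, HasDerivAt (fun x => 2 * y₀ - x) (-1) x := fun x => by
      simpa using (hasDerivAt_id x).const_sub (2 * y₀)
    have e : 2 * y₀ - (y₀ + -t) = y₀ + t := by ring
    have e₀ : 2 * y₀ - y₀ = y₀ := by ring
    have := bounds_right_of_max (r := fun x => r (2 * y₀ - x))
      (r₁ := fun x => -r₁ (2 * y₀ - x)) (r₂ := fun x => r₂ (2 * y₀ - x)) (y₀ := y₀) hk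
      (fun x => ((hr (2 * y₀ - x)).comp x (hs x)).congr_deriv (by ring))
      (fun x => ((hr₁ (2 * y₀ - x)).comp x (hs x)).neg.congr_deriv (by ring))
      (fun x => hr₂ _) (fun x => by simpa only [e₀] using hmax _) (neg_nonneg.2 ht) hkt
    simpa only [e, e₀, abs_neg] using this

/-- If `(a, b)'' · (a, b) ≥ -k² |(a, b)|²`, then near a maximum point of `a² + b²` with value `1`
the modulus stays above the cosine and its logarithmic derivative obeys the tangent bound. The
proof regularizes the modulus to `√(a² + b² + ε)`, which is smooth. -/
lemma modulus_bounds_near_max {a b a₁ b₁ a₂ b₂ : ℝ → ℝ} {k y₀ t : ℝ} (hk : 0 < k)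
    (ha : ∀ x, HasDerivAt a (a₁ x) x) (hb : ∀ x, HasDerivAt b (b₁ x) x)
    (ha₁ : ∀ x, HasDerivAt a₁ (a₂ x) x) (hb₁ : ∀ x, HasDerivAt b₁ (b₂ x) x)
    (h₂ : ∀ x, -(k ^ 2 * (a x ^ 2 + b x ^ 2)) ≤ a x * a₂ x + b x * b₂ x)
    (hle : ∀ x, a x ^ 2 + b x ^ 2 ≤ 1) (hy₀ : a y₀ ^ 2 + b y₀ ^ 2 = 1)
    (hkt : k * |t| < π / 2) :
    cos (k * |t|) ^ 2 ≤ a (y₀ + t) ^ 2 + b (y₀ + t) ^ 2 ∧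
      |a (y₀ + t) * a₁ (y₀ + t) + b (y₀ + t) * b₁ (y₀ + t)| * cos (k * |t|) ≤
        k * (a (y₀ + t) ^ 2 + b (y₀ + t) ^ 2) * sin (k * |t|) := by
  have hpi := pi_pos
  have hkt0 : 0 ≤ k * |t| := by positivity
  have hct : 0 < cos (k * |t|) := cos_pos_of_mem_Ioo ⟨by linarith, hkt⟩
  have hst : 0 ≤ sin (k * |t|) := sin_nonneg_of_nonneg_of_le_pi hkt0 (by linarith)
  have key : ∀ ε : ℝ, 0 < ε → (1 + ε) * cos (k * |t|) ^ 2 ≤ a (y₀ + t) ^ 2 + b (y₀ + t) ^ 2 + ε ∧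
      |a (y₀ + t) * a₁ (y₀ + t) + b (y₀ + t) * b₁ (y₀ + t)| * cos (k * |t|) ≤
        k * (a (y₀ + t) ^ 2 + b (y₀ + t) ^ 2 + ε) * sin (k * |t|) := by
    intro ε hε
    have hpos : ∀ x, 0 < a x ^ 2 + b x ^ 2 + ε := fun x => by positivity
    set r : ℝ → ℝ := fun x => √(a x ^ 2 + b x ^ 2 + ε) with hrdef
    have hrpos : ∀ x, 0 < r x := fun x => sqrt_pos.2 (hpos x)
    have hrsq : ∀ x, r x ^ 2 = a x ^ 2 + b x ^ 2 + ε := fun x => sq_sqrt (hpos x).le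
    set P : ℝ → ℝ := fun x => a x * a₁ x + b x * b₁ x with hP
    have hr : ∀ x, HasDerivAt r (P x / r x) x := fun x => by
      refine (((((ha x).pow 2).add ((hb x).pow 2)).add_const ε).sqrt (hpos x).ne').congr_deriv ?_
      have := (hrpos x).ne'
      simp only [hP]
      change _ / (2 * r x) = _
      field_simp
      norm_num
      ring
    have hP₁ : ∀ x, HasDerivAt P
        (a₁ x * a₁ x + a x * a₂ x + (b₁ x * b₁ x + b x * b₂ x)) x := fun x =>
      ((ha x).mul (ha₁ x)).add ((hb x).mul (hb₁ x))
    have hr₂ : ∀ x, 0 ≤ ((a₁ x * a₁ x + a x * a₂ x + (b₁ x * b₁ x + b x * b₂ x)) * r x -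
        P x * (P x / r x)) / r x ^ 2 + k ^ 2 * r x := by
      intro x
      have h0 := hrpos x
      have hPle : P x ^ 2 ≤ (a₁ x ^ 2 + b₁ x ^ 2) * r x ^ 2 := by
        rw [hrsq]
        simp only [hP]
        nlinarith [sq_nonneg (a x * b₁ x - b x * a₁ x),
          mul_nonneg (add_nonneg (sq_nonneg (a₁ x)) (sq_nonneg (b₁ x))) hε.le]
      have hkr : k ^ 2 * r x ^ 2 = k ^ 2 * (a x ^ 2 + b x ^ 2) + k ^ 2 * ε := by
        rw [hrsq]; ring
      have e : ((a₁ x * a₁ x + a x * a₂ x + (b₁ x * b₁ x + b x * b₂ x)) * r x -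
          P x * (P x / r x)) / r x ^ 2 + k ^ 2 * r x =
          (((a₁ x ^ 2 + b₁ x ^ 2) * r x ^ 2 - P x ^ 2) +
            (a x * a₂ x + b x * b₂ x + k ^ 2 * r x ^ 2) * r x ^ 2) / r x ^ 3 := by
        field_simp
        ring
      rw [e]
      have h3 : 0 ≤ a x * a₂ x + b x * b₂ x + k ^ 2 * r x ^ 2 := by
        have := h₂ x
        have : 0 ≤ k ^ 2 * ε := by positivity
        linarith
      have := mul_nonneg h3 (sq_nonneg (r x))
      exact div_nonneg (by linarith) (by positivity)
    have hmax : ∀ x, r x ≤ r y₀ := fun x => sqrt_le_sqrt (by linarith [hle x])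
    obtain ⟨h, h'⟩ := bounds_near_max hk hr (fun x => (hP₁ x).div (hr x) (hrpos x).ne') hr₂ hmax hkt
    have h0 := hrpos (y₀ + t)
    constructor
    · have := pow_le_pow_left₀ (mul_nonneg (hrpos y₀).le hct.le) h 2
      rwa [mul_pow, hrsq, hrsq, hy₀] at this
    · rw [abs_div, abs_of_pos h0, div_mul_eq_mul_div, div_le_iff₀ h0] at h'
      rw [← hrsq]
      linarith
  constructor
  · refine le_of_forall_pos_le_add fun ε hε => ?_
    nlinarith [(key ε hε).1, mul_nonneg hε.le (sq_nonneg (cos (k * |t|)))]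
  · refine le_of_forall_pos_le_add fun ε hε => ?_
    have h := (key (ε / k) (by positivity)).2
    have e : k * (a (y₀ + t) ^ 2 + b (y₀ + t) ^ 2 + ε / k) * sin (k * |t|) =
        k * (a (y₀ + t) ^ 2 + b (y₀ + t) ^ 2) * sin (k * |t|) + ε * sin (k * |t|) := by
      field_simp
    nlinarith [sin_le_one (k * |t|)]

/-- The integral bound for the squared phase derivative, in real coordinates. -/
lemma integral_sq_phase_deriv_le {a b a₁ b₁ a₂ b₂ : ℝ → ℝ} {k y₀ δ : ℝ} (hk : 0 < k)
    (ha : ∀ x, HasDerivAt a (a₁ x) x) (hb : ∀ x, HasDerivAt b (b₁ x) x)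
    (ha₁ : ∀ x, HasDerivAt a₁ (a₂ x) x) (hb₁ : ∀ x, HasDerivAt b₁ (b₂ x) x)
    (h₂ : ∀ x, -(k ^ 2 * (a x ^ 2 + b x ^ 2)) ≤ a x * a₂ x + b x * b₂ x)
    (hle : ∀ x, a x ^ 2 + b x ^ 2 ≤ 1) (hy₀ : a y₀ ^ 2 + b y₀ ^ 2 = 1)
    (hδ : 0 < δ) (hkδ : k * δ < π / 2) :
    (∫ y in (y₀ - δ)..(y₀ + δ), (a y * b₁ y - b y * a₁ y) ^ 2 / (a y ^ 2 + b y ^ 2) ^ 2) ≤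
      4 * k * tan (k * δ) := by
  have hpi := pi_pos
  have habs : ∀ y ∈ Icc (y₀ - δ) (y₀ + δ), k * |y - y₀| < π / 2 := fun y hy => by
    have : |y - y₀| ≤ δ := abs_le.2 ⟨by linarith [hy.1], by linarith [hy.2]⟩
    nlinarith
  have hcabs : ∀ y, cos (k * |y - y₀|) = cos (k * (y - y₀)) := fun y => by
    rw [← cos_abs (k * (y - y₀)), abs_mul, abs_of_pos hk]
  have hcos : ∀ y ∈ Icc (y₀ - δ) (y₀ + δ), 0 < cos (k * (y - y₀)) := fun y hy => by
    rw [← hcabs]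
    exact cos_pos_of_mem_Ioo ⟨by nlinarith [abs_nonneg (y - y₀)], habs y hy⟩
  have hbd : ∀ y ∈ Icc (y₀ - δ) (y₀ + δ), 0 < a y ^ 2 + b y ^ 2 ∧
      |(a y * a₁ y + b y * b₁ y) / (a y ^ 2 + b y ^ 2)| ≤ k * tan (k * |y - y₀|) := by
    intro y hy
    obtain ⟨h, h'⟩ := modulus_bounds_near_max hk ha hb ha₁ hb₁ h₂ hle hy₀ (habs y hy)
    rw [add_sub_cancel] at h h'
    have hc := hcos y hy
    rw [← hcabs] at hc
    have hs : 0 < a y ^ 2 + b y ^ 2 := lt_of_lt_of_le (by positivity) h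
    refine ⟨hs, ?_⟩
    rw [abs_div, abs_of_pos hs, div_le_iff₀ hs, tan_eq_sin_div_cos, mul_div_assoc',
      div_mul_eq_mul_div, le_div_iff₀ hc]
    linarith
  have hG : ∀ y ∈ Icc (y₀ - δ) (y₀ + δ), HasDerivAt
      (fun y => (a y * a₁ y + b y * b₁ y) / (a y ^ 2 + b y ^ 2) + k * tan (k * (y - y₀)))
      (((a₁ y ^ 2 + b₁ y ^ 2 + (a y * a₂ y + b y * b₂ y)) * (a y ^ 2 + b y ^ 2) -
        2 * (a y * a₁ y + b y * b₁ y) ^ 2) / (a y ^ 2 + b y ^ 2) ^ 2 +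
        k ^ 2 / cos (k * (y - y₀)) ^ 2) y := by
    intro y hy
    have h0 : HasDerivAt (fun z => k * (z - y₀)) k y := by
      simpa using ((hasDerivAt_id y).sub_const y₀).const_mul k
    have ht := ((hasDerivAt_tan (hcos y hy).ne').comp y h0).const_mul k
    have hp := (((ha y).mul (ha₁ y)).add ((hb y).mul (hb₁ y))).div
      (((ha y).pow 2).add ((hb y).pow 2)) (hbd y hy).1.ne'
    refine (hp.add ht).congr_deriv ?_
    simp only [Pi.add_apply, Pi.mul_apply, Pi.pow_apply]
    norm_num
    ring
  have hcont : ∀ {g g₁ : ℝ → ℝ}, (∀ x, HasDerivAt g (g₁ x) x) → Continuous g := fun h =>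
    continuous_iff_continuousAt.2 fun x => (h x).continuousAt
  have hint : ContinuousOn
      (fun y => (a y * b₁ y - b y * a₁ y) ^ 2 / (a y ^ 2 + b y ^ 2) ^ 2)
      (Icc (y₀ - δ) (y₀ + δ)) := by
    have := hcont ha
    have := hcont hb
    have := hcont ha₁
    have := hcont hb₁
    exact ContinuousOn.div (by fun_prop) (by fun_prop) fun y hy => (pow_pos (hbd y hy).1 2).ne'
  have hmain := intervalIntegral.integral_le_sub_of_hasDeriv_right_of_le
    (by linarith : y₀ - δ ≤ y₀ + δ)
    (fun y hy => (hG y hy).continuousAt.continuousWithinAt)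
    (fun y hy => (hG y (Ioo_subset_Icc_self hy)).hasDerivWithinAt)
    hint.integrableOn_Icc
    (fun y hy => by
      have hy := Ioo_subset_Icc_self hy
      obtain ⟨hs, hp⟩ := hbd y hy
      have hc := hcos y hy
      have hsq := pow_le_pow_left₀ (abs_nonneg _) hp 2
      rw [sq_abs, mul_pow, tan_eq_sin_div_cos, div_pow (sin _), sin_sq, hcabs] at hsq
      have e₁ : k ^ 2 * ((1 - cos (k * (y - y₀)) ^ 2) / cos (k * (y - y₀)) ^ 2) =
          k ^ 2 / cos (k * (y - y₀)) ^ 2 - k ^ 2 := by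
        field_simp
      have e₂ : (a y * b₁ y - b y * a₁ y) ^ 2 / (a y ^ 2 + b y ^ 2) ^ 2 =
          ((a₁ y ^ 2 + b₁ y ^ 2 + (a y * a₂ y + b y * b₂ y)) * (a y ^ 2 + b y ^ 2) -
            2 * (a y * a₁ y + b y * b₁ y) ^ 2) / (a y ^ 2 + b y ^ 2) ^ 2 +
          ((a y * a₁ y + b y * b₁ y) / (a y ^ 2 + b y ^ 2)) ^ 2 -
          (a y * a₂ y + b y * b₂ y) / (a y ^ 2 + b y ^ 2) := by
        field_simp
        ring
      have h3 : -k ^ 2 ≤ (a y * a₂ y + b y * b₂ y) / (a y ^ 2 + b y ^ 2) := by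
        rw [le_div_iff₀ hs]
        linarith [h₂ y]
      rw [e₂]
      linarith)
  refine hmain.trans ?_
  have hr := (hbd (y₀ + δ) (right_mem_Icc.2 (by linarith))).2
  have hl := (hbd (y₀ - δ) (left_mem_Icc.2 (by linarith))).2
  have el : y₀ - δ - y₀ = -δ := by ring
  rw [add_sub_cancel_left, abs_of_pos hδ] at hr
  rw [el, abs_neg, abs_of_pos hδ] at hl
  simp only [add_sub_cancel_left, el, mul_neg, tan_neg]
  linarith [(abs_le.1 hr).2, (abs_le.1 hl).1]

/-- `L²` bound on `θ' = Im(f' f̄)/|f|²` near a maximum point: if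
`-f'' + iuf = μ f̄` with `μ > 0`, `sup |f| = 1` and `|f(y₀)| = 1`, then for
`0 < δ < π/(2√μ)`,
`∫_{y₀-δ}^{y₀+δ} Im(f' f̄)²/|f|⁴ ≤ 4 √μ tan(√μ δ)`. -/
theorem stmt_10 (u : ℝ → ℝ) (hu : Continuous u) (huper : Function.Periodic u (2 * Real.pi))
    (μ : ℝ) (hμ : 0 < μ)
    (f : ℝ → ℂ) (hf : ContDiff ℝ 2 f) (hfper : Function.Periodic f (2 * Real.pi))
    (heq : ∀ y, -(deriv (deriv f)) y + Complex.I * (u y : ℂ) * f y =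
      (μ : ℂ) * (starRingEnd ℂ) (f y))
    (hsup : ∀ y, ‖f y‖ ≤ 1) (y₀ : ℝ) (hy₀ : ‖f y₀‖ = 1) :
    ∀ δ : ℝ, 0 < δ → δ < Real.pi / (2 * Real.sqrt μ) →
      (∫ y in (y₀ - δ)..(y₀ + δ),
          ((deriv f y * (starRingEnd ℂ) (f y)).im) ^ 2 / ‖f y‖ ^ 4) ≤
        4 * Real.sqrt μ * Real.tan (Real.sqrt μ * δ) := by
  intro δ hδ hδ'
  have hk : 0 < √μ := Real.sqrt_pos.2 hμ
  have hkδ : √μ * δ < π / 2 := by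
    rw [lt_div_iff₀ (by positivity)] at hδ'
    linarith
  have hd : ∀ x, HasDerivAt f (deriv f x) x := fun x =>
    (hf.differentiable (by norm_num) x).hasDerivAt
  have hdd : ∀ x, HasDerivAt (deriv f) (deriv (deriv f) x) x := fun x =>
    ((hf.iterate_deriv' 1 1).differentiable (by norm_num) x).hasDerivAt
  have hre : ∀ {g : ℝ → ℂ} {g' : ℂ} {x : ℝ}, HasDerivAt g g' x →
      HasDerivAt (fun x => (g x).re) g'.re x := fun h =>
    Complex.reCLM.hasFDerivAt.comp_hasDerivAt _ h
  have him : ∀ {g : ℝ → ℂ} {g' : ℂ} {x : ℝ}, HasDerivAt g g' x →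
      HasDerivAt (fun x => (g x).im) g'.im x := fun h =>
    Complex.imCLM.hasFDerivAt.comp_hasDerivAt _ h
  have hn : ∀ x, (f x).re ^ 2 + (f x).im ^ 2 = ‖f x‖ ^ 2 := fun x => by
    rw [Complex.sq_norm, Complex.normSq_apply]
    ring
  have h := integral_sq_phase_deriv_le hk (fun x => hre (hd x)) (fun x => him (hd x))
    (fun x => hre (hdd x)) (fun x => him (hdd x))
    (fun x => by
      have h1 := congrArg Complex.re (heq x)
      have h2 := congrArg Complex.im (heq x)
      simp at h1 h2
      rw [Real.sq_sqrt hμ.le]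
      have e1 : (deriv (deriv f) x).re = -(u x * (f x).im) - μ * (f x).re := by linarith
      have e2 : (deriv (deriv f) x).im = u x * (f x).re + μ * (f x).im := by linarith
      rw [e1, e2]
      nlinarith [mul_nonneg hμ.le (sq_nonneg (f x).im)])
    (fun x => by
      rw [hn]
      exact pow_le_one₀ (norm_nonneg _) (hsup x))
    (by rw [hn, hy₀, one_pow]) hδ hkδ
  convert h using 3 with y
  rw [hn, ← pow_mul]
  congr 2
  simp only [Complex.mul_im, Complex.conj_re, Complex.conj_im]
  ring
end

section
/- Let u : ℝ → ℝ be continuous and 2π-periodic, let ψ : ℝ → ℝ be differentiable with ψ' = u, define ω₀(δ,u) = inf_{x,c∈ℝ} ∫_{x−δ}^{x+δ} |ψ(y) − c|² dy and ω₁(δ,u) = inf_{x,c₁,c₂∈ℝ} ∫_{x−δ}^{x+δ} |ψ(y) − c₁ − c₂ y|² dy. Define Ψ₀(u) = inf{ ‖−f'' + i u f‖_{L²(0,2π)} : f twice continuously differentiable, 2π-periodic, ‖f‖_{L²(0,2π)} = 1 } and Ψ₁(u) = inf_{λ∈ℝ} Ψ₀(u − λ). Then for every δ > 0 and every s ∈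 [0, π/2) with 36 s tan s ≤ δ ω₀(δ,u) one has Ψ₀(u) ≥ (s/δ)², and for every s ∈ [0, π/2) with 36 s tan s ≤ δ ω₁(δ,u) one has Ψ₁(u) ≥ (s/δ)². Equivalently, Ψ₀(u) ≥ (φ^{−1}(δ ω₀(δ,u))/δ)² and Ψ₁(u) ≥ (φ^{−1}(δ ω₁(δ,u))/δ)², where φ^{−1} is the inverse of the increasing bijection φ : [0,π/2) → [0,∞), φ(x) = 36 x tan x. -/
/-- The `L²(0, 2π)` norm of a (`2π`-periodic) function `f : ℝ → ℂ`. -/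
noncomputable def l2norm (f : ℝ → ℂ) : ℝ :=
  Real.sqrt (∫ y in (0 : ℝ)..(2 * Real.pi), ‖f y‖ ^ 2)

/-- `Ψ₀(u) = inf{‖-f'' + iuf‖_{L²} : f` C², `2π`-periodic, `‖f‖_{L²} = 1}`. -/
noncomputable def Psi0 (u : ℝ → ℝ) : ℝ :=
  sInf {r : ℝ | ∃ f : ℝ → ℂ, ContDiff ℝ 2 f ∧ Function.Periodic f (2 * Real.pi) ∧
    l2norm f = 1 ∧ r = l2norm fun y => -(deriv (deriv f)) y + Complex.I * (u y : ℂ) * f y}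

/-- `Ψ₁(u) = inf_{λ ∈ ℝ} Ψ₀(u - λ)`. -/
noncomputable def Psi1 (u : ℝ → ℝ) : ℝ :=
  sInf {r : ℝ | ∃ lam : ℝ, r = Psi0 fun y => u y - lam}

/-- `ω₀(δ, u) = inf_{x, c} ∫_{x-δ}^{x+δ} |ψ(y) - c|² dy`, where `ψ' = u`. -/
noncomputable def omega0 (δ : ℝ) (ψ : ℝ → ℝ) : ℝ :=
  sInf {r : ℝ | ∃ x c : ℝ, r = ∫ y in (x - δ)..(x + δ), (ψ y - c) ^ 2}

/-- `ω₁(δ, u) = inf_{x, c₁, c₂} ∫_{x-δ}^{x+δ} |ψ(y) - c₁ - c₂y|² dy`. -/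
noncomputable def omega1 (δ : ℝ) (ψ : ℝ → ℝ) : ℝ :=
  sInf {r : ℝ | ∃ x c₁ c₂ : ℝ, r = ∫ y in (x - δ)..(x + δ), (ψ y - c₁ - c₂ * y) ^ 2}

/-- Sturm comparison of `r'' + μ² r ≥ 0` with `cos (θ - μ t)`. -/
lemma sturm_comparison {r r₁ r₂ : ℝ → ℝ} {μ θ b : ℝ} (hμ : 0 < μ) (hb : 0 ≤ b)
    (hr : ∀ t, HasDerivAt r (r₁ t) t) (hr₁ : ∀ t, HasDerivAt r₁ (r₂ t) t)
    (hr₂ : ∀ t, 0 ≤ r₂ t + μ ^ 2 * r t) (hθ : θ < Real.pi / 2)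
    (hθb : -(Real.pi / 2) < θ - μ * b)
    (h0 : μ * r 0 * Real.sin θ ≤ r₁ 0 * Real.cos θ) :
    r 0 * Real.cos (θ - μ * b) ≤ r b * Real.cos θ := by
  have hpos : ∀ t ∈ Set.Icc 0 b, 0 < Real.cos (θ - μ * t) := fun t ht =>
    Real.cos_pos_of_mem_Ioo ⟨by nlinarith [ht.2], by nlinarith [ht.1]⟩
  have hlin : ∀ t : ℝ, HasDerivAt (fun t => θ - μ * t) (-μ) t := fun t => by
    simpa using ((hasDerivAt_id t).const_mul μ).const_sub θ
  have hc : ∀ t, HasDerivAt (fun t => Real.cos (θ - μ * t)) (μ * Real.sin (θ - μ * t)) t :=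
    fun t => (hlin t).cos.congr_deriv (by ring)
  have hs : ∀ t, HasDerivAt (fun t => Real.sin (θ - μ * t)) (-μ * Real.cos (θ - μ * t)) t :=
    fun t => (hlin t).sin.congr_deriv (by ring)
  have hW : ∀ t, HasDerivAt
      (fun t => r₁ t * Real.cos (θ - μ * t) - r t * (μ * Real.sin (θ - μ * t)))
      ((r₂ t + μ ^ 2 * r t) * Real.cos (θ - μ * t)) t := fun t =>
    (((hr₁ t).mul (hc t)).sub ((hr t).mul ((hs t).const_mul μ))).congr_deriv (by ring)
  have hWmono : MonotoneOn
      (fun t => r₁ t * Real.cos (θ - μ * t) - r t * (μ * Real.sin (θ - μ * t)))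
      (Set.Icc 0 b) := by
    refine monotoneOn_of_hasDerivWithinAt_nonneg (convex_Icc 0 b)
      (fun t _ => (hW t).continuousAt.continuousWithinAt)
      (fun t _ => (hW t).hasDerivWithinAt) fun t ht => ?_
    exact mul_nonneg (hr₂ t) (hpos t (interior_subset ht)).le
  have hWnn : ∀ t ∈ Set.Icc 0 b,
      0 ≤ r₁ t * Real.cos (θ - μ * t) - r t * (μ * Real.sin (θ - μ * t)) := fun t ht => by
    have := hWmono (Set.left_mem_Icc.2 hb) ht ht.1
    simp only [mul_zero, sub_zero] at this
    nlinarith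
  have hQ : ∀ t ∈ Set.Icc 0 b, HasDerivAt (fun t => r t / Real.cos (θ - μ * t))
      ((r₁ t * Real.cos (θ - μ * t) - r t * (μ * Real.sin (θ - μ * t))) /
        Real.cos (θ - μ * t) ^ 2) t :=
    fun t ht => (hr t).div (hc t) (hpos t ht).ne'
  have hQmono : MonotoneOn (fun t => r t / Real.cos (θ - μ * t)) (Set.Icc 0 b) := by
    refine monotoneOn_of_hasDerivWithinAt_nonneg (convex_Icc 0 b)
      (fun t ht => (hQ t ht).continuousAt.continuousWithinAt)
      (fun t ht => (hQ t (interior_subset ht)).hasDerivWithinAt) fun t ht => ?_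
    exact div_nonneg (hWnn t (interior_subset ht)) (sq_nonneg _)
  have := hQmono (Set.left_mem_Icc.2 hb) (Set.right_mem_Icc.2 hb) hb
  have h1 := hpos 0 (Set.left_mem_Icc.2 hb)
  have h2 := hpos b (Set.right_mem_Icc.2 hb)
  simp only [mul_zero, sub_zero] at this h1
  rwa [div_le_div_iff₀ h1 h2] at this

/-- A positive solution of `r'' + μ² r ≥ 0` bounded by `m` has energy at most `μ² m²`,
at a point where `r` is nondecreasing. -/
lemma energy_le_of_deriv_nonneg {r r₁ r₂ : ℝ → ℝ} {μ m : ℝ} (hμ : 0 < μ)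
    (hr : ∀ t, HasDerivAt r (r₁ t) t) (hr₁ : ∀ t, HasDerivAt r₁ (r₂ t) t)
    (hr₂ : ∀ t, 0 ≤ r₂ t + μ ^ 2 * r t) (hpos : ∀ t, 0 < r t) (hm : ∀ t, r t ≤ m)
    (h : 0 ≤ r₁ 0) : r₁ 0 ^ 2 + μ ^ 2 * r 0 ^ 2 ≤ μ ^ 2 * m ^ 2 := by
  set q := r₁ 0 / (μ * r 0) with hq
  have hr0 := hpos 0
  have hqnn : 0 ≤ q := by positivity
  have hcos := Real.cos_arctan_pos q
  have hsin : Real.sin (Real.arctan q) = q * Real.cos (Real.arctan q) := by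
    rw [← Real.tan_mul_cos hcos.ne', Real.tan_arctan]
  have hr₁q : r₁ 0 = q * (μ * r 0) := by rw [hq]; field_simp
  have key := sturm_comparison (θ := Real.arctan q) (b := Real.arctan q / μ) hμ
    (div_nonneg (Real.arctan_nonneg.2 hqnn) hμ.le) hr hr₁ hr₂ (Real.arctan_lt_pi_div_two q)
    (by rw [mul_div_cancel₀ _ hμ.ne']; linarith [Real.pi_pos])
    (by rw [hsin, hr₁q]; apply le_of_eq; ring)
  rw [mul_div_cancel₀ _ hμ.ne', sub_self, Real.cos_zero, mul_one] at key
  have h1 : r 0 ≤ m * Real.cos (Real.arctan q) :=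
    key.trans (mul_le_mul_of_nonneg_right (hm _) hcos.le)
  have h2 : r 0 ^ 2 ≤ m ^ 2 * Real.cos (Real.arctan q) ^ 2 := by
    rw [← mul_pow]; exact pow_le_pow_left₀ hr0.le h1 2
  rw [Real.cos_sq_arctan, mul_one_div, le_div_iff₀ (by positivity)] at h2
  rw [hr₁q]
  nlinarith [mul_le_mul_of_nonneg_left h2 (sq_nonneg μ)]

lemma energy_le {r r₁ r₂ : ℝ → ℝ} {μ m : ℝ} (hμ : 0 < μ)
    (hr : ∀ t, HasDerivAt r (r₁ t) t) (hr₁ : ∀ t, HasDerivAt r₁ (r₂ t) t)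
    (hr₂ : ∀ t, 0 ≤ r₂ t + μ ^ 2 * r t) (hpos : ∀ t, 0 < r t) (hm : ∀ t, r t ≤ m)
    (a : ℝ) : r₁ a ^ 2 + μ ^ 2 * r a ^ 2 ≤ μ ^ 2 * m ^ 2 := by
  rcases le_total 0 (r₁ a) with h | h
  · have := energy_le_of_deriv_nonneg (r := fun t => r (a + t)) (r₁ := fun t => r₁ (a + t))
      (r₂ := fun t => r₂ (a + t)) hμ (fun t => (hr (a + t)).comp_const_add a t)
      (fun t => (hr₁ (a + t)).comp_const_add a t) (fun t => hr₂ _) (fun t => hpos _)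
      (fun t => hm _) (by simpa using h)
    simpa using this
  · have := energy_le_of_deriv_nonneg (r := fun t => r (a - t)) (r₁ := fun t => -r₁ (a - t))
      (r₂ := fun t => r₂ (a - t)) hμ (fun t => (hr (a - t)).comp_const_sub a t)
      (fun t => ((hr₁ (a - t)).comp_const_sub a t).neg.congr_deriv (neg_neg _))
      (fun t => hr₂ _) (fun t => hpos _) (fun t => hm _) (by simpa using h)
    simpa using this

/-- Bounds for `R = |F|²` where `F` is vector valued with `⟨F'', F⟩ ≥ -μ² |F|²` and `|F|` is
maximal at `0`. Here `P = ⟨F', F⟩` and `D = |F'|²`. -/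
lemma sq_norm_bounds {R P D P' : ℝ → ℝ} {μ : ℝ} (hμ : 0 < μ)
    (hR : ∀ t, HasDerivAt R (2 * P t) t) (hP : ∀ t, HasDerivAt P (P' t) t)
    (hP' : ∀ t, D t - μ ^ 2 * R t ≤ P' t) (hPD : ∀ t, P t ^ 2 ≤ R t * D t)
    (hD : ∀ t, 0 ≤ D t) (hRnn : ∀ t, 0 ≤ R t) (hmax : ∀ t, R t ≤ R 0) :
    (∀ t, 0 ≤ t → μ * t < Real.pi / 2 → R 0 * Real.cos (μ * t) ^ 2 ≤ R t) ∧
      ∀ t, P t ^ 2 ≤ μ ^ 2 * (R t * (R 0 - R t)) := by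
  have hP0 : P 0 = 0 := by
    have hloc : IsLocalMax R 0 := Filter.Eventually.of_forall hmax
    linarith [hloc.hasDerivAt_eq_zero (hR 0)]
  have hsq : ∀ ε > 0, ∀ t, 0 < √(R t + ε) ∧ √(R t + ε) ^ 2 = R t + ε := fun ε hε t =>
    ⟨Real.sqrt_pos.2 (by linarith [hRnn t]), Real.sq_sqrt (by linarith [hRnn t])⟩
  have hr : ∀ ε > 0, ∀ t, HasDerivAt (fun t => √(R t + ε)) (P t / √(R t + ε)) t := by
    intro ε hε t
    convert ((hR t).add_const ε).sqrt (by linarith [hRnn t]) using 1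
    rw [mul_div_mul_left _ _ two_ne_zero]
  have hr₁ : ∀ ε > 0, ∀ t, HasDerivAt (fun t => P t / √(R t + ε))
      ((P' t * √(R t + ε) - P t * (P t / √(R t + ε))) / √(R t + ε) ^ 2) t :=
    fun ε hε t => (hP t).div (hr ε hε t) (hsq ε hε t).1.ne'
  have hr₂ : ∀ ε > 0, ∀ t, 0 ≤ (P' t * √(R t + ε) - P t * (P t / √(R t + ε))) /
      √(R t + ε) ^ 2 + μ ^ 2 * √(R t + ε) := by
    intro ε hε t
    obtain ⟨h1, h2⟩ := hsq ε hε t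
    have : (P' t * √(R t + ε) - P t * (P t / √(R t + ε))) / √(R t + ε) ^ 2 +
        μ ^ 2 * √(R t + ε) = (P' t * √(R t + ε) ^ 2 - P t ^ 2 +
          μ ^ 2 * (√(R t + ε) ^ 2) ^ 2) / √(R t + ε) ^ 3 := by
      field_simp
    rw [this, h2]
    refine div_nonneg ?_ (by positivity)
    have h3 := mul_le_mul_of_nonneg_right (hP' t) (by linarith [hRnn t] : 0 ≤ R t + ε)
    nlinarith [hPD t, mul_nonneg hε.le (hD t), mul_nonneg (sq_nonneg μ)
      (mul_nonneg hε.le (by linarith [hRnn t] : 0 ≤ R t + ε))]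
  constructor
  · intro t ht hμt
    refine le_of_forall_pos_le_add fun ε hε => ?_
    have key := sturm_comparison (θ := 0) hμ ht (hr ε hε) (hr₁ ε hε) (hr₂ ε hε)
      (by positivity) (by linarith) (by simp [hP0])
    rw [zero_sub, Real.cos_neg, Real.cos_zero, mul_one] at key
    have hcos : 0 ≤ Real.cos (μ * t) :=
      Real.cos_nonneg_of_mem_Icc ⟨by nlinarith [Real.pi_pos], hμt.le⟩
    have := pow_le_pow_left₀ (mul_nonneg (hsq ε hε 0).1.le hcos) key 2
    rw [mul_pow, (hsq ε hε 0).2, (hsq ε hε t).2] at this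
    nlinarith [sq_nonneg (Real.cos (μ * t))]
  · intro t
    have hε : ∀ ε > 0, P t ^ 2 ≤ μ ^ 2 * ((R t + ε) * (R 0 - R t)) := by
      intro ε hε
      have := energy_le (m := √(R 0 + ε)) hμ (hr ε hε) (hr₁ ε hε) (hr₂ ε hε)
        (fun t => (hsq ε hε t).1)
        (fun t => Real.sqrt_le_sqrt (by linarith [hmax t])) t
      rw [div_pow, (hsq ε hε 0).2, (hsq ε hε t).2] at this
      have hpos : 0 < R t + ε := by linarith [hRnn t]
      have h3 : P t ^ 2 / (R t + ε) ≤ μ ^ 2 * (R 0 - R t) := by linarith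
      rw [div_le_iff₀ hpos] at h3
      linarith
    have hlim : Filter.Tendsto (fun ε => μ ^ 2 * ((R t + ε) * (R 0 - R t)))
        (nhdsWithin 0 (Set.Ioi 0)) (nhds (μ ^ 2 * ((R t + 0) * (R 0 - R t)))) :=
      (Continuous.tendsto (by fun_prop) 0).mono_left nhdsWithin_le_nhds
    rw [add_zero] at hlim
    exact ge_of_tendsto hlim (by filter_upwards [self_mem_nhdsWithin] with ε h using hε ε h)

/-- The one-sided estimate `∫₀^δ (ψ - c)² ≤ 18 μ tan (μ δ)` to the right of a maximum of `R`. -/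
lemma integral_sq_le_of_max {R P D N J S u ψ : ℝ → ℝ} {μ δ : ℝ} (hμ : 0 < μ) (hδ : 0 ≤ δ)
    (hμδ : μ * δ < Real.pi / 2)
    (hR : ∀ t, HasDerivAt R (2 * P t) t)
    (hP : ∀ t, HasDerivAt P (D t - μ ^ 2 * R t + μ ^ 2 * N t) t)
    (hJ : ∀ t, HasDerivAt J (u t * R t + 2 * μ ^ 2 * S t) t)
    (hψ : ∀ t, HasDerivAt ψ (u t) t)
    (hPJ : ∀ t, P t ^ 2 + J t ^ 2 ≤ R t * D t)
    (hS : ∀ t, (2 * S t) ^ 2 ≤ 2 * (N t * R t)) (hD : ∀ t, 0 ≤ D t) (hN : ∀ t, 0 ≤ N t)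
    (hRnn : ∀ t, 0 ≤ R t) (hmax : ∀ t, R t ≤ R 0) (hR0 : 0 < R 0) :
    ∫ t in (0 : ℝ)..δ, (ψ t - (ψ 0 - J 0 / R 0)) ^ 2 ≤ 18 * (μ * Real.tan (μ * δ)) := by
  set c := ψ 0 - J 0 / R 0 with hc
  obtain ⟨hlow, hen⟩ := sq_norm_bounds (D := D) hμ hR hP
    (fun t => by nlinarith [mul_nonneg (sq_nonneg μ) (hN t)])
    (fun t => by nlinarith [hPJ t, sq_nonneg (J t)]) hD hRnn hmax
  have hP0 : P 0 = 0 := by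
    have hloc : IsLocalMax R 0 := Filter.Eventually.of_forall hmax
    linarith [hloc.hasDerivAt_eq_zero (hR 0)]
  have hcos : ∀ t ∈ Set.Icc 0 δ, 0 < Real.cos (μ * t) := fun t ht =>
    Real.cos_pos_of_mem_Ioo ⟨by nlinarith [ht.1, Real.pi_pos], by nlinarith [ht.2]⟩
  have hlow' : ∀ t ∈ Set.Icc 0 δ, R 0 * Real.cos (μ * t) ^ 2 ≤ R t := fun t ht =>
    hlow t ht.1 (by nlinarith [ht.2])
  have hRpos : ∀ t ∈ Set.Icc 0 δ, 0 < R t := fun t ht =>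
    lt_of_lt_of_le (by have := hcos t ht; positivity) (hlow' t ht)
  let T : ℝ → ℝ := fun t => μ * Real.tan (μ * t)
  have hTnn : ∀ t ∈ Set.Icc 0 δ, 0 ≤ T t := fun t ht => mul_nonneg hμ.le
    (Real.tan_nonneg_of_nonneg_of_le_pi_div_two (mul_nonneg hμ.le ht.1) (by nlinarith [ht.2]))
  have hT : ∀ t ∈ Set.Icc 0 δ, HasDerivAt T (μ ^ 2 + T t ^ 2) t := by
    intro t ht
    have h1 : HasDerivAt (fun t => μ * t) μ t := by simpa using (hasDerivAt_id t).const_mul μ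
    refine (((Real.hasDerivAt_tan (hcos t ht).ne').comp t h1).const_mul μ).congr_deriv ?_
    have := hcos t ht
    simp only [T, Real.tan_eq_sin_div_cos]
    field_simp
    linarith [Real.sin_sq_add_cos_sq (μ * t)]
  let q : ℝ → ℝ := fun t => P t / R t
  let η : ℝ → ℝ := fun t => J t / R t
  let n : ℝ → ℝ := fun t => μ ^ 2 * N t / R t
  let E : ℝ → ℝ := fun t => D t / R t + n t - q t ^ 2
  have hqT : ∀ t ∈ Set.Icc 0 δ, q t ^ 2 ≤ T t ^ 2 := by
    intro t ht
    have h1 := hRpos t ht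
    have h2 := hcos t ht
    have h3 := hlow' t ht
    have h4 : R 0 - R t ≤ Real.tan (μ * t) ^ 2 * R t := by
      rw [Real.tan_eq_sin_div_cos, div_pow, div_mul_eq_mul_div, le_div_iff₀ (by positivity)]
      nlinarith [Real.sin_sq_add_cos_sq (μ * t)]
    simp only [q, T]
    rw [div_pow, div_le_iff₀ (by positivity), mul_pow]
    calc P t ^ 2 ≤ μ ^ 2 * (R t * (R 0 - R t)) := hen t
      _ ≤ μ ^ 2 * (R t * (Real.tan (μ * t) ^ 2 * R t)) := by gcongr
      _ = _ := by ring
  have hq : ∀ t ∈ Set.Icc 0 δ, HasDerivAt q (E t - μ ^ 2 - q t ^ 2) t := by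
    intro t ht
    have h1 := hRpos t ht
    refine ((hP t).div (hR t) h1.ne').congr_deriv ?_
    simp only [q, E, n]
    field_simp
    ring
  have hη : ∀ t ∈ Set.Icc 0 δ,
      HasDerivAt η (u t + 2 * μ ^ 2 * S t / R t - 2 * (η t * q t)) t := by
    intro t ht
    have h1 := hRpos t ht
    refine ((hJ t).div (hR t) h1.ne').congr_deriv ?_
    simp only [q, η]
    field_simp
  have hEη : ∀ t ∈ Set.Icc 0 δ, η t ^ 2 + n t ≤ E t := by
    intro t ht
    have h1 := hRpos t ht
    have : (P t ^ 2 + J t ^ 2) / R t ^ 2 ≤ D t / R t := by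
      rw [div_le_div_iff₀ (by positivity) h1]
      nlinarith [mul_le_mul_of_nonneg_right (hPJ t) h1.le]
    simp only [η, q, E, div_pow]
    rw [add_div] at this
    linarith
  have hn : ∀ t ∈ Set.Icc 0 δ, 0 ≤ n t := fun t ht =>
    div_nonneg (mul_nonneg (sq_nonneg _) (hN t)) (hRpos t ht).le
  have hSn : ∀ t ∈ Set.Icc 0 δ, (2 * μ ^ 2 * S t / R t) ^ 2 ≤ 2 * μ ^ 2 * n t := by
    intro t ht
    have h1 := hRpos t ht
    simp only [n]
    rw [div_pow, mul_div_assoc', div_le_div_iff₀ (by positivity) h1]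
    nlinarith [mul_le_mul_of_nonneg_left (hS t) (by positivity : 0 ≤ μ ^ 4 * R t)]
  have hint : ∀ t ∈ Set.Icc 0 δ, |2 * (η t * q t) - 2 * μ ^ 2 * S t / R t| ≤
      √2 / 2 * E t + √2 * (μ ^ 2 + T t ^ 2) := by
    intro t ht
    have h2 : √2 ^ 2 = 2 := Real.sq_sqrt (by norm_num)
    have h0 : 0 ≤ √2 := Real.sqrt_nonneg 2
    have hE := hEη t ht
    have hnt := hn t ht
    have hqt := hqT t ht
    have hEnn : 0 ≤ E t := by nlinarith [sq_nonneg (η t)]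
    set a := 2 * μ ^ 2 * S t / R t with ha
    have haS : a ^ 2 ≤ 2 * μ ^ 2 * n t := hSn t ht
    refine abs_le_of_sq_le_sq ?_ (by positivity)
    have hcs : (2 * (η t * q t) - a) ^ 2 ≤ (η t ^ 2 + n t) * (4 * q t ^ 2 + 2 * μ ^ 2) := by
      rcases eq_or_lt_of_le hnt with h | h
      · rw [← h, mul_zero] at haS
        have : a = 0 := by nlinarith
        rw [this, ← h]
        nlinarith [mul_nonneg (sq_nonneg (η t)) (sq_nonneg μ)]
      · have h4 : -(2 * (2 * (η t * q t)) * a) * n t ≤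
            (2 * q t * n t) ^ 2 + (η t * a) ^ 2 := by
          nlinarith [sq_nonneg (2 * q t * n t + η t * a)]
        have h5 : (η t * a) ^ 2 ≤ η t ^ 2 * (2 * μ ^ 2 * n t) := by
          rw [mul_pow]; gcongr
        have h6 : -(2 * (2 * (η t * q t)) * a) ≤ 4 * q t ^ 2 * n t + η t ^ 2 * (2 * μ ^ 2) := by
          refine le_of_mul_le_mul_right ?_ h
          linarith
        nlinarith
    calc (2 * (η t * q t) - a) ^ 2 ≤ (η t ^ 2 + n t) * (4 * q t ^ 2 + 2 * μ ^ 2) := hcs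
      _ ≤ E t * (4 * (μ ^ 2 + T t ^ 2)) :=
        mul_le_mul hE (by nlinarith [sq_nonneg μ]) (by positivity) hEnn
      _ ≤ (√2 / 2 * E t + √2 * (μ ^ 2 + T t ^ 2)) ^ 2 := by
        nlinarith [sq_nonneg (√2 / 2 * E t - √2 * (μ ^ 2 + T t ^ 2))]
  let G : ℝ → ℝ := fun t => ψ t - c - η t
  have hG : ∀ t ∈ Set.Icc 0 δ,
      HasDerivAt G (2 * (η t * q t) - 2 * μ ^ 2 * S t / R t) t := by
    intro t ht
    exact (((hψ t).sub_const c).sub (hη t ht)).congr_deriv (by ring)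
  have hG0 : G 0 = 0 := by simp only [G, hc, η]; ring
  have hq0 : q 0 = 0 := by simp only [q, hP0, zero_div]
  have hT0 : T 0 = 0 := by simp [T]
  have hbound : ∀ σ : ℝ, |σ| = 1 → ∀ t ∈ Set.Icc 0 δ,
      σ * G t ≤ √2 / 2 * (q t + T t) + √2 * T t := by
    intro σ hσ t ht
    have hmono : MonotoneOn (fun t => √2 / 2 * (q t + T t) + √2 * T t - σ * G t)
        (Set.Icc 0 δ) := by
      have hd : ∀ t ∈ Set.Icc 0 δ, HasDerivAt
          (fun t => √2 / 2 * (q t + T t) + √2 * T t - σ * G t)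
          (√2 / 2 * ((E t - μ ^ 2 - q t ^ 2) + (μ ^ 2 + T t ^ 2)) + √2 * (μ ^ 2 + T t ^ 2)
            - σ * (2 * (η t * q t) - 2 * μ ^ 2 * S t / R t)) t := fun t ht =>
        ((((hq t ht).add (hT t ht)).const_mul _).add ((hT t ht).const_mul _)).sub
          ((hG t ht).const_mul σ)
      refine monotoneOn_of_hasDerivWithinAt_nonneg (convex_Icc 0 δ)
        (fun t ht => (hd t ht).continuousAt.continuousWithinAt)
        (fun t ht => (hd t (interior_subset ht)).hasDerivWithinAt) fun t ht => ?_
      have ht' : t ∈ Set.Icc 0 δ := interior_subset ht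
      have h1 := hint t ht'
      have h2 : σ * (2 * (η t * q t) - 2 * μ ^ 2 * S t / R t) ≤
          |2 * (η t * q t) - 2 * μ ^ 2 * S t / R t| := by
        refine (le_abs_self _).trans ?_
        rw [abs_mul, hσ, one_mul]
      have h3 : 0 ≤ √2 / 2 * (T t ^ 2 - q t ^ 2) :=
        mul_nonneg (by positivity) (by linarith [hqT t ht'])
      nlinarith
    have := hmono (Set.left_mem_Icc.2 hδ) ht ht.1
    simp only [hG0, hq0, hT0] at this
    linarith
  have hGT : ∀ t ∈ Set.Icc 0 δ, G t ^ 2 ≤ 8 * T t ^ 2 := by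
    intro t ht
    have h1 := hbound 1 (by simp) t ht
    have h2 := hbound (-1) (by simp) t ht
    have h3 : q t ≤ T t := abs_le_of_sq_le_sq' (hqT t ht) (hTnn t ht) |>.2
    have h4 : √2 / 2 * (q t + T t) + √2 * T t ≤ 2 * √2 * T t := by
      nlinarith [mul_le_mul_of_nonneg_left h3 (Real.sqrt_nonneg 2)]
    have h5 : G t ^ 2 ≤ (2 * √2 * T t) ^ 2 := sq_le_sq' (by linarith) (by linarith)
    have h6 : √2 ^ 2 = 2 := Real.sq_sqrt (by norm_num)
    calc G t ^ 2 ≤ (2 * √2 * T t) ^ 2 := h5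
      _ = 8 * T t ^ 2 := by rw [mul_pow, mul_pow, h6]; ring
  have hψc : Continuous ψ := continuous_iff_continuousAt.2 fun t => (hψ t).continuousAt
  have hcont : Continuous fun t => (ψ t - c) ^ 2 := by fun_prop
  have hmono : MonotoneOn (fun t => 3 * q t + 15 * T t - ∫ s in (0 : ℝ)..t, (ψ s - c) ^ 2)
      (Set.Icc 0 δ) := by
    have hd : ∀ t ∈ Set.Icc 0 δ, HasDerivAt
        (fun t => 3 * q t + 15 * T t - ∫ s in (0 : ℝ)..t, (ψ s - c) ^ 2)
        (3 * (E t - μ ^ 2 - q t ^ 2) + 15 * (μ ^ 2 + T t ^ 2) - (ψ t - c) ^ 2) t :=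
      fun t ht => (((hq t ht).const_mul _).add ((hT t ht).const_mul _)).sub
        (intervalIntegral.integral_hasDerivAt_right (hcont.intervalIntegrable _ _)
          (hcont.stronglyMeasurableAtFilter _ _) hcont.continuousAt)
    refine monotoneOn_of_hasDerivWithinAt_nonneg (convex_Icc 0 δ)
      (fun t ht => (hd t ht).continuousAt.continuousWithinAt)
      (fun t ht => (hd t (interior_subset ht)).hasDerivWithinAt) fun t ht => ?_
    have ht' : t ∈ Set.Icc 0 δ := interior_subset ht
    have h1 : ψ t - c = G t + η t := by simp only [G]; ring
    have h2 := hGT t ht'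
    have h3 := hEη t ht'
    have h4 := hn t ht'
    have h5 := hqT t ht'
    rw [h1]
    nlinarith [sq_nonneg (G t - 2 * η t), sq_nonneg μ]
  have := hmono (Set.left_mem_Icc.2 hδ) (Set.right_mem_Icc.2 hδ) hδ
  simp only [hq0, hT0, intervalIntegral.integral_same] at this
  have h3 : q δ ≤ T δ := abs_le_of_sq_le_sq' (hqT δ (Set.right_mem_Icc.2 hδ))
    (hTnn δ (Set.right_mem_Icc.2 hδ)) |>.2
  change _ ≤ 18 * T δ
  linarith

/-- The two-sided version of `integral_sq_le_of_max` around a maximum `a` of `R`. -/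
lemma integral_sq_le_of_max_symm {R P D N J S u ψ : ℝ → ℝ} {μ δ a : ℝ} (hμ : 0 < μ)
    (hδ : 0 ≤ δ) (hμδ : μ * δ < Real.pi / 2)
    (hR : ∀ t, HasDerivAt R (2 * P t) t)
    (hP : ∀ t, HasDerivAt P (D t - μ ^ 2 * R t + μ ^ 2 * N t) t)
    (hJ : ∀ t, HasDerivAt J (u t * R t + 2 * μ ^ 2 * S t) t)
    (hψ : ∀ t, HasDerivAt ψ (u t) t)
    (hPJ : ∀ t, P t ^ 2 + J t ^ 2 ≤ R t * D t)
    (hS : ∀ t, (2 * S t) ^ 2 ≤ 2 * (N t * R t)) (hD : ∀ t, 0 ≤ D t) (hN : ∀ t, 0 ≤ N t)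
    (hRnn : ∀ t, 0 ≤ R t) (hmax : ∀ t, R t ≤ R a) (hRa : 0 < R a) :
    ∫ t in (a - δ)..(a + δ), (ψ t - (ψ a - J a / R a)) ^ 2 ≤
      36 * (μ * Real.tan (μ * δ)) := by
  have h1 := integral_sq_le_of_max (R := fun t => R (a + t)) (P := fun t => P (a + t))
    (D := fun t => D (a + t)) (N := fun t => N (a + t)) (J := fun t => J (a + t))
    (S := fun t => S (a + t)) (u := fun t => u (a + t)) (ψ := fun t => ψ (a + t)) hμ hδ hμδ
    (fun t => (hR _).comp_const_add a t) (fun t => (hP _).comp_const_add a t)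
    (fun t => (hJ _).comp_const_add a t) (fun t => (hψ _).comp_const_add a t)
    (fun t => hPJ _) (fun t => hS _) (fun t => hD _) (fun t => hN _) (fun t => hRnn _)
    (fun t => by simpa using hmax _) (by simpa using hRa)
  have h2 := integral_sq_le_of_max (R := fun t => R (a - t)) (P := fun t => -P (a - t))
    (D := fun t => D (a - t)) (N := fun t => N (a - t)) (J := fun t => -J (a - t))
    (S := fun t => S (a - t)) (u := fun t => u (a - t)) (ψ := fun t => -ψ (a - t)) hμ hδ hμδ
    (fun t => ((hR _).comp_const_sub a t).congr_deriv (by ring))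
    (fun t => ((hP _).comp_const_sub a t).neg.congr_deriv (by ring))
    (fun t => ((hJ _).comp_const_sub a t).neg.congr_deriv (by ring))
    (fun t => ((hψ _).comp_const_sub a t).neg.congr_deriv (by ring))
    (fun t => by simpa using hPJ _) (fun t => hS _) (fun t => hD _) (fun t => hN _)
    (fun t => hRnn _) (fun t => by simpa using hmax _) (by simpa using hRa)
  simp only [add_zero, sub_zero] at h1 h2
  have h3 : ∀ t, (-ψ (a - t) - (-ψ a - -J a / R a)) ^ 2 =
      (ψ (a - t) - (ψ a - J a / R a)) ^ 2 := fun t => by ring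
  simp only [h3] at h2
  rw [intervalIntegral.integral_comp_add_left (fun t => (ψ t - (ψ a - J a / R a)) ^ 2)] at h1
  rw [intervalIntegral.integral_comp_sub_left (fun t => (ψ t - (ψ a - J a / R a)) ^ 2)] at h2
  simp only [add_zero, sub_zero] at h1 h2
  have hψc : Continuous ψ := continuous_iff_continuousAt.2 fun t => (hψ t).continuousAt
  have hcont : Continuous fun t => (ψ t - (ψ a - J a / R a)) ^ 2 := by fun_prop
  rw [← intervalIntegral.integral_add_adjacent_intervals
    (hcont.intervalIntegrable (a - δ) a) (hcont.intervalIntegrable a (a + δ))]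
  linarith

lemma HasDerivAt.re_ofReal {f : ℝ → ℂ} {f' : ℂ} {x : ℝ} (h : HasDerivAt f f' x) :
    HasDerivAt (fun y => (f y).re) f'.re x :=
  Complex.reCLM.hasFDerivAt.comp_hasDerivAt x h

lemma HasDerivAt.im_ofReal {f : ℝ → ℂ} {f' : ℂ} {x : ℝ} (h : HasDerivAt f f' x) :
    HasDerivAt (fun y => (f y).im) f'.im x :=
  Complex.imCLM.hasFDerivAt.comp_hasDerivAt x h

/-- Oscillation bound for a potential `u = ψ'` for which the system `-f'' + iuf = αg`,
`-g'' - iug = βf` has a nontrivial solution whose modulus attains its maximum. -/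
lemma exists_integral_sq_le_of_system {u ψ : ℝ → ℝ} {f f₁ g g₁ : ℝ → ℂ} {α β μ δ a : ℝ}
    (hμ : 0 < μ) (hμ2 : 2 * μ ^ 2 = α + β) (hδ : 0 ≤ δ) (hμδ : μ * δ < Real.pi / 2)
    (hψ : ∀ t, HasDerivAt ψ (u t) t)
    (hf : ∀ t, HasDerivAt f (f₁ t) t)
    (hf₁ : ∀ t, HasDerivAt f₁ (Complex.I * u t * f t - α * g t) t)
    (hg : ∀ t, HasDerivAt g (g₁ t) t)
    (hg₁ : ∀ t, HasDerivAt g₁ (-(Complex.I * u t * g t) - β * f t) t)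
    (hmax : ∀ t, Complex.normSq (f t) + Complex.normSq (g t) ≤
      Complex.normSq (f a) + Complex.normSq (g a))
    (hpos : 0 < Complex.normSq (f a) + Complex.normSq (g a)) :
    ∃ c : ℝ, ∫ t in (a - δ)..(a + δ), (ψ t - c) ^ 2 ≤ 36 * (μ * Real.tan (μ * δ)) := by
  have hfr := fun t => (hf t).re_ofReal
  have hfi := fun t => (hf t).im_ofReal
  have hgr := fun t => (hg t).re_ofReal
  have hgi := fun t => (hg t).im_ofReal
  have hf₁r := fun t => (hf₁ t).re_ofReal
  have hf₁i := fun t => (hf₁ t).im_ofReal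
  have hg₁r := fun t => (hg₁ t).re_ofReal
  have hg₁i := fun t => (hg₁ t).im_ofReal
  simp only [Complex.sub_re, Complex.sub_im, Complex.mul_re, Complex.mul_im, Complex.neg_re,
    Complex.neg_im, Complex.I_re, Complex.I_im, Complex.ofReal_re, Complex.ofReal_im]
    at hf₁r hf₁i hg₁r hg₁i
  simp only [Complex.normSq_apply] at hmax hpos
  have hβ : β = 2 * μ ^ 2 - α := by linarith
  subst hβ
  exact ⟨_, integral_sq_le_of_max_symm
    (R := fun t => (f t).re * (f t).re + (f t).im * (f t).im +
      ((g t).re * (g t).re + (g t).im * (g t).im))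
    (P := fun t => (f t).re * (f₁ t).re + (f t).im * (f₁ t).im +
      ((g t).re * (g₁ t).re + (g t).im * (g₁ t).im))
    (D := fun t => (f₁ t).re ^ 2 + (f₁ t).im ^ 2 + ((g₁ t).re ^ 2 + (g₁ t).im ^ 2))
    (N := fun t => ((f t).re - (g t).re) ^ 2 + ((f t).im - (g t).im) ^ 2)
    (J := fun t => (f t).re * (f₁ t).im - (f t).im * (f₁ t).re -
      ((g t).re * (g₁ t).im - (g t).im * (g₁ t).re))
    (S := fun t => (f t).im * (g t).re - (f t).re * (g t).im) (u := u) hμ hδ hμδ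
    (fun t => ((((hfr t).mul (hfr t)).add ((hfi t).mul (hfi t))).add
      (((hgr t).mul (hgr t)).add ((hgi t).mul (hgi t)))).congr_deriv (by ring))
    (fun t => ((((hfr t).mul (hf₁r t)).add ((hfi t).mul (hf₁i t))).add
      (((hgr t).mul (hg₁r t)).add ((hgi t).mul (hg₁i t)))).congr_deriv (by ring))
    (fun t => ((((hfr t).mul (hf₁i t)).sub ((hfi t).mul (hf₁r t))).sub
      (((hgr t).mul (hg₁i t)).sub ((hgi t).mul (hg₁r t)))).congr_deriv (by ring))
    hψ
    (fun t => by
      nlinarith [sq_nonneg ((f₁ t).re * (g t).re + (f₁ t).im * (g t).im -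
          ((g₁ t).re * (f t).re + (g₁ t).im * (f t).im)),
        sq_nonneg ((f₁ t).im * (g t).re - (f₁ t).re * (g t).im -
          ((g₁ t).re * (f t).im - (g₁ t).im * (f t).re))])
    (fun t => by
      nlinarith [sq_nonneg (((f t).re - (g t).re) ^ 2 + ((f t).im - (g t).im) ^ 2),
        sq_nonneg ((f t).re ^ 2 + (f t).im ^ 2 - ((g t).re ^ 2 + (g t).im ^ 2))])
    (fun t => by positivity) (fun t => by positivity)
    (fun t => by nlinarith [mul_self_nonneg (f t).re, mul_self_nonneg (f t).im,
      mul_self_nonneg (g t).re, mul_self_nonneg (g t).im])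
    hmax hpos⟩

/-- The real `L²(0, 2π)` inner product. -/
noncomputable def l2inner (f g : ℝ → ℂ) : ℝ :=
  ∫ y in (0 : ℝ)..(2 * Real.pi), inner ℝ (f y) (g y)

section l2inner

variable {f g h k : ℝ → ℂ}

lemma l2inner_comm (f g : ℝ → ℂ) : l2inner f g = l2inner g f := by
  simp only [l2inner, real_inner_comm]

lemma l2inner_add_left (hf : Continuous f) (hg : Continuous g) (hh : Continuous h) :
    l2inner (fun y => f y + g y) h = l2inner f h + l2inner g h := by
  simp only [l2inner, inner_add_left]
  exact intervalIntegral.integral_add ((hf.inner hh).intervalIntegrable _ _)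
    ((hg.inner hh).intervalIntegrable _ _)

lemma l2inner_sub_left (hf : Continuous f) (hg : Continuous g) (hh : Continuous h) :
    l2inner (fun y => f y - g y) h = l2inner f h - l2inner g h := by
  simp only [l2inner, inner_sub_left]
  exact intervalIntegral.integral_sub ((hf.inner hh).intervalIntegrable _ _)
    ((hg.inner hh).intervalIntegrable _ _)

lemma l2inner_smul_left (c : ℝ) (f g : ℝ → ℂ) :
    l2inner (fun y => c * f y) g = c * l2inner f g := by
  simp only [l2inner, ← Complex.real_smul, real_inner_smul_left]
  exact intervalIntegral.integral_const_mul _ _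

lemma l2inner_add_right (hf : Continuous f) (hg : Continuous g) (hh : Continuous h) :
    l2inner h (fun y => f y + g y) = l2inner h f + l2inner h g := by
  rw [l2inner_comm, l2inner_add_left hf hg hh, l2inner_comm f, l2inner_comm g]

lemma l2inner_sub_right (hf : Continuous f) (hg : Continuous g) (hh : Continuous h) :
    l2inner h (fun y => f y - g y) = l2inner h f - l2inner h g := by
  rw [l2inner_comm, l2inner_sub_left hf hg hh, l2inner_comm f, l2inner_comm g]

lemma l2inner_smul_right (c : ℝ) (f g : ℝ → ℂ) :
    l2inner g (fun y => c * f y) = c * l2inner g f := by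
  rw [l2inner_comm, l2inner_smul_left, l2inner_comm]

lemma l2inner_self (f : ℝ → ℂ) :
    l2inner f f = ∫ y in (0 : ℝ)..(2 * Real.pi), ‖f y‖ ^ 2 := by
  simp only [l2inner, real_inner_self_eq_norm_sq]

lemma l2inner_self_nonneg (f : ℝ → ℂ) : 0 ≤ l2inner f f := by
  rw [l2inner_self]
  exact intervalIntegral.integral_nonneg Real.two_pi_pos.le fun _ _ => sq_nonneg _

lemma l2norm_eq_sqrt (f : ℝ → ℂ) : l2norm f = √(l2inner f f) := by
  rw [l2norm, l2inner_self]

lemma l2inner_self_mono (hf : Continuous f) (hg : Continuous g) {C : ℝ}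
    (h : ∀ y, ‖f y‖ ^ 2 ≤ C * ‖g y‖ ^ 2) : l2inner f f ≤ C * l2inner g g := by
  rw [l2inner_self, l2inner_self, ← intervalIntegral.integral_const_mul]
  exact intervalIntegral.integral_mono_on Real.two_pi_pos.le
    ((by fun_prop : Continuous fun y => ‖f y‖ ^ 2).intervalIntegrable _ _)
    ((by fun_prop : Continuous fun y => C * ‖g y‖ ^ 2).intervalIntegrable _ _) fun y _ => h y

lemma l2inner_self_le_const (hf : Continuous f) {C : ℝ} (h : ∀ y, ‖f y‖ ^ 2 ≤ C) :
    l2inner f f ≤ 2 * Real.pi * C := by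
  rw [l2inner_self]
  calc ∫ y in (0 : ℝ)..(2 * Real.pi), ‖f y‖ ^ 2 ≤ ∫ _y in (0 : ℝ)..(2 * Real.pi), C :=
        intervalIntegral.integral_mono_on Real.two_pi_pos.le
          ((by fun_prop : Continuous fun y => ‖f y‖ ^ 2).intervalIntegrable _ _)
          (continuous_const.intervalIntegrable _ _) fun y _ => h y
    _ = 2 * Real.pi * C := by simp

lemma norm_add_sq_le_two_mul (a b : ℂ) : ‖a + b‖ ^ 2 ≤ 2 * ‖a‖ ^ 2 + 2 * ‖b‖ ^ 2 := by
  have := pow_le_pow_left₀ (norm_nonneg _) (norm_add_le a b) 2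
  nlinarith [sq_nonneg (‖a‖ - ‖b‖)]

lemma l2inner_add_self_le (hf : Continuous f) (hg : Continuous g) :
    l2inner (fun y => f y + g y) (fun y => f y + g y) ≤ 2 * l2inner f f + 2 * l2inner g g := by
  rw [l2inner_self, l2inner_self, l2inner_self, ← intervalIntegral.integral_const_mul,
    ← intervalIntegral.integral_const_mul, ← intervalIntegral.integral_add]
  · exact intervalIntegral.integral_mono_on Real.two_pi_pos.le
      ((by fun_prop : Continuous fun y => ‖f y + g y‖ ^ 2).intervalIntegrable _ _)
      ((by fun_prop : Continuous fun y => 2 * ‖f y‖ ^ 2 + 2 * ‖g y‖ ^ 2).intervalIntegrable _ _)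
      fun y _ => norm_add_sq_le_two_mul _ _
  · exact (by fun_prop : Continuous fun y => 2 * ‖f y‖ ^ 2).intervalIntegrable _ _
  · exact (by fun_prop : Continuous fun y => 2 * ‖g y‖ ^ 2).intervalIntegrable _ _

end l2inner

lemma sq_integral_le {h : ℝ → ℝ} (hh : Continuous h) {a b : ℝ} (hab : a ≤ b) :
    (∫ t in a..b, h t) ^ 2 ≤ (b - a) * ∫ t in a..b, h t ^ 2 := by
  rcases hab.eq_or_lt with rfl | hab
  · simp
  set I := ∫ t in a..b, h t with hI
  have hpos : 0 < b - a := sub_pos.2 hab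
  have h0 : 0 ≤ ∫ t in a..b, (h t - I / (b - a)) ^ 2 :=
    intervalIntegral.integral_nonneg hab.le fun _ _ => sq_nonneg _
  have h1 : ∫ t in a..b, (h t - I / (b - a)) ^ 2 =
      (∫ t in a..b, h t ^ 2) - I ^ 2 / (b - a) := by
    have : ∀ t, (h t - I / (b - a)) ^ 2 =
        h t ^ 2 - 2 * (I / (b - a)) * h t + (I / (b - a)) ^ 2 := fun t => by ring
    simp only [this]
    rw [intervalIntegral.integral_add, intervalIntegral.integral_sub,
      intervalIntegral.integral_const_mul, intervalIntegral.integral_const, ← hI, smul_eq_mul]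
    · field_simp
      ring
    all_goals exact Continuous.intervalIntegrable (by fun_prop) _ _
  rw [h1, sub_nonneg, div_le_iff₀ hpos] at h0
  linarith

/-- `φ` is a `2π`-periodic solution of `φ - φ'' = ξ`. -/
structure IsHelmholtzSol (φ ξ : ℝ → ℂ) : Prop where
  periodic : Function.Periodic φ (2 * Real.pi)
  continuous_rhs : Continuous ξ
  exists_deriv : ∃ φ₁ : ℝ → ℂ, (∀ x, HasDerivAt φ (φ₁ x) x) ∧
    ∀ x, HasDerivAt φ₁ (φ x - ξ x) x

lemma Function.Periodic.of_hasDerivAt {φ φ₁ : ℝ → ℂ} {c : ℝ} (h : Function.Periodic φ c)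
    (hd : ∀ x, HasDerivAt φ (φ₁ x) x) : Function.Periodic φ₁ c := fun x => by
  have h1 : HasDerivAt (fun y => φ (y + c)) (φ₁ (x + c)) x := (hd (x + c)).comp_add_const x c
  rw [funext h] at h1
  exact h1.unique (hd x)

/-- First order linear equations with `2π`-periodic right-hand side have periodic solutions. -/
lemma exists_periodic_first_order {a : ℝ} (ha : a ≠ 0) {ξ : ℝ → ℂ} (hξ : Continuous ξ)
    (hper : Function.Periodic ξ (2 * Real.pi)) :
    ∃ v : ℝ → ℂ, Function.Periodic v (2 * Real.pi) ∧
      ∀ x, HasDerivAt v ((a : ℂ) * v x + ξ x) x := by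
  set e : ℝ → ℂ := fun t => Complex.exp (a * t) with he
  set k : ℝ → ℂ := fun t => Complex.exp (-(a * t)) * ξ t with hk
  have hkc : Continuous k := by fun_prop
  set I : ℝ → ℂ := fun x => ∫ t in (0 : ℝ)..x, k t with hI
  have hne : e (2 * Real.pi) - 1 ≠ 0 := by
    have : e (2 * Real.pi) = ((Real.exp (a * (2 * Real.pi)) : ℝ) : ℂ) := by simp [he]
    rw [this, sub_ne_zero, ← Complex.ofReal_one, Ne, Complex.ofReal_inj, Real.exp_eq_one_iff]
    have := Real.pi_pos
    positivity
  set C : ℂ := -(e (2 * Real.pi) * I (2 * Real.pi)) / (e (2 * Real.pi) - 1) with hC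
  have hCe : e (2 * Real.pi) * (C + I (2 * Real.pi)) = C := by
    have : C * (e (2 * Real.pi) - 1) = -(e (2 * Real.pi) * I (2 * Real.pi)) :=
      div_mul_cancel₀ _ hne
    linear_combination this
  have hee : ∀ x y, e (x + y) = e x * e y := fun x y => by
    simp only [he]; rw [← Complex.exp_add]; push_cast; ring_nf
  have hIadd : ∀ x, e (2 * Real.pi) * I (x + 2 * Real.pi) =
      e (2 * Real.pi) * I (2 * Real.pi) + I x := by
    intro x
    have h1 : I (x + 2 * Real.pi) =
        I (2 * Real.pi) + ∫ t in (2 * Real.pi)..(x + 2 * Real.pi), k t :=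
      (intervalIntegral.integral_add_adjacent_intervals (hkc.intervalIntegrable _ _)
        (hkc.intervalIntegrable _ _)).symm
    have h2 : ∫ t in (2 * Real.pi)..(x + 2 * Real.pi), k t =
        ∫ t in (0 : ℝ)..x, k (t + 2 * Real.pi) := by
      rw [intervalIntegral.integral_comp_add_right, zero_add]
    have h3 : ∀ t, e (2 * Real.pi) * k (t + 2 * Real.pi) = k t := fun t => by
      simp only [he, hk, hper t]
      rw [← mul_assoc, ← Complex.exp_add]
      push_cast
      ring_nf
    rw [h1, h2, mul_add, ← intervalIntegral.integral_const_mul (e (2 * Real.pi))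
      fun t => k (t + 2 * Real.pi)]
    simp only [h3, hI]
  refine ⟨fun x => e x * (C + I x), fun x => ?_, fun x => ?_⟩
  · change e (x + 2 * Real.pi) * (C + I (x + 2 * Real.pi)) = e x * (C + I x)
    rw [hee]
    linear_combination e x * hIadd x + e x * hCe
  · have h1 : HasDerivAt e (a * e x) x := by
      have h0 : HasDerivAt (fun t : ℝ => (a : ℂ) * t) a x := by
        simpa using (Complex.ofRealCLM.hasDerivAt (x := x)).const_mul (a : ℂ)
      exact h0.cexp.congr_deriv (mul_comm _ _)
    have h2 : HasDerivAt I (k x) x :=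
      intervalIntegral.integral_hasDerivAt_right (hkc.intervalIntegrable _ _)
        (hkc.stronglyMeasurableAtFilter _ _) hkc.continuousAt
    have h3 : e x * k x = ξ x := by
      simp only [he, hk]
      rw [← mul_assoc, ← Complex.exp_add, add_neg_cancel, Complex.exp_zero, one_mul]
    refine (h1.mul (h2.const_add C)).congr_deriv ?_
    rw [h3]
    ring

lemma exists_isHelmholtzSol {ξ : ℝ → ℂ} (hξ : Continuous ξ)
    (hper : Function.Periodic ξ (2 * Real.pi)) : ∃ φ, IsHelmholtzSol φ ξ := by
  obtain ⟨w, hw, hwd⟩ := exists_periodic_first_order one_ne_zero (ξ := fun x => -ξ x)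
    hξ.neg fun x => by simp [hper x]
  have hwc : Continuous w := continuous_iff_continuousAt.2 fun x => (hwd x).continuousAt
  obtain ⟨φ, hφ, hφd⟩ := exists_periodic_first_order (a := -1) (by norm_num) hwc hw
  refine ⟨φ, hφ, hξ, _, hφd, fun x => ?_⟩
  refine (((hφd x).const_mul _).add (hwd x)).congr_deriv ?_
  push_cast
  ring

namespace IsHelmholtzSol

variable {φ ξ ζ η : ℝ → ℂ}

lemma continuous (h : IsHelmholtzSol φ ξ) : Continuous φ := by
  obtain ⟨φ₁, h1, -⟩ := h.exists_deriv
  exact continuous_iff_continuousAt.2 fun x => (h1 x).continuousAt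

lemma sub (h : IsHelmholtzSol φ ξ) (h' : IsHelmholtzSol ζ η) :
    IsHelmholtzSol (fun x => φ x - ζ x) (fun x => ξ x - η x) := by
  obtain ⟨φ₁, h1, h2⟩ := h.exists_deriv
  obtain ⟨ζ₁, h1', h2'⟩ := h'.exists_deriv
  exact ⟨fun x => by simp [h.periodic x, h'.periodic x], h.continuous_rhs.sub h'.continuous_rhs,
    fun x => φ₁ x - ζ₁ x, fun x => (h1 x).sub (h1' x),
    fun x => ((h2 x).sub (h2' x)).congr_deriv (by ring)⟩

/-- The solution operator is symmetric. -/
lemma l2inner_symm (h : IsHelmholtzSol φ ξ) (h' : IsHelmholtzSol ζ η) :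
    l2inner ξ ζ = l2inner φ η := by
  have hφ := h.continuous
  have hζ := h'.continuous
  have hξ := h.continuous_rhs
  have hη := h'.continuous_rhs
  obtain ⟨φ₁, h1, h2⟩ := h.exists_deriv
  obtain ⟨ζ₁, h1', h2'⟩ := h'.exists_deriv
  have hper := h.periodic.of_hasDerivAt h1
  have hper' := h'.periodic.of_hasDerivAt h1'
  have hd : ∀ x ∈ Set.uIcc 0 (2 * Real.pi),
      HasDerivAt (fun x => inner ℝ (φ x) (ζ₁ x) - inner ℝ (φ₁ x) (ζ x))
        (inner ℝ (ξ x) (ζ x) - inner ℝ (φ x) (η x)) x := fun x _ => by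
    refine (((h1 x).inner ℝ (h2' x)).sub ((h2 x).inner ℝ (h1' x))).congr_deriv ?_
    simp only [inner_sub_left, inner_sub_right]
    ring
  have := intervalIntegral.integral_eq_sub_of_hasDerivAt hd
    (((hξ.inner hζ).sub (hφ.inner hη)).intervalIntegrable _ _)
  rw [intervalIntegral.integral_sub ((hξ.inner hζ).intervalIntegrable _ _)
    ((hφ.inner hη).intervalIntegrable _ _), h.periodic.eq, h'.periodic.eq, hper.eq, hper'.eq,
    sub_self] at this
  simp only [l2inner]
  linarith

lemma energy (h : IsHelmholtzSol φ ξ) {φ₁ : ℝ → ℂ} (h1 : ∀ x, HasDerivAt φ (φ₁ x) x)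
    (h2 : ∀ x, HasDerivAt φ₁ (φ x - ξ x) x) :
    l2inner φ φ + l2inner φ₁ φ₁ ≤ l2inner ξ ξ := by
  have hφ := h.continuous
  have hξ := h.continuous_rhs
  have hφ₁ : Continuous φ₁ := continuous_iff_continuousAt.2 fun x => (h2 x).continuousAt
  have hper := h.periodic.of_hasDerivAt h1
  have hd : ∀ x ∈ Set.uIcc 0 (2 * Real.pi), HasDerivAt (fun x => inner ℝ (φ₁ x) (φ x))
      (inner ℝ (φ₁ x) (φ₁ x) + inner ℝ (φ x) (φ x) - inner ℝ (ξ x) (φ x)) x := fun x _ => by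
    refine ((h2 x).inner ℝ (h1 x)).congr_deriv ?_
    simp only [inner_sub_left]
    ring
  have := intervalIntegral.integral_eq_sub_of_hasDerivAt hd
    ((((hφ₁.inner hφ₁).add (hφ.inner hφ)).sub (hξ.inner hφ)).intervalIntegrable _ _)
  rw [intervalIntegral.integral_sub (((hφ₁.inner hφ₁).add (hφ.inner hφ)).intervalIntegrable _ _)
    ((hξ.inner hφ).intervalIntegrable _ _),
    intervalIntegral.integral_add ((hφ₁.inner hφ₁).intervalIntegrable _ _)
    ((hφ.inner hφ).intervalIntegrable _ _), h.periodic.eq, hper.eq, sub_self] at this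
  have h3 := l2inner_self_nonneg fun x => ξ x - φ x
  have hsub : Continuous fun x => ξ x - φ x := hξ.sub hφ
  rw [l2inner_sub_left hξ hφ hsub, l2inner_sub_right hξ hφ hξ,
    l2inner_sub_right hξ hφ hφ, l2inner_comm φ ξ] at h3
  have h4 := l2inner_self_nonneg φ₁
  simp only [l2inner] at h3 h4 this ⊢
  linarith

lemma holder_aux (h : IsHelmholtzSol φ ξ) {x y : ℝ} (hx : 0 ≤ x) (hxy : x ≤ y)
    (hy : y ≤ 2 * Real.pi) : ‖φ y - φ x‖ ^ 2 ≤ (y - x) * l2inner ξ ξ := by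
  obtain ⟨φ₁, h1, h2⟩ := h.exists_deriv
  have hφ₁ : Continuous φ₁ := continuous_iff_continuousAt.2 fun x => (h2 x).continuousAt
  have hen := h.energy h1 h2
  have hn : Continuous fun t => ‖φ₁ t‖ ^ 2 := by fun_prop
  rw [← intervalIntegral.integral_eq_sub_of_hasDerivAt (fun t _ => h1 t)
    (hφ₁.intervalIntegrable x y)]
  calc ‖∫ t in x..y, φ₁ t‖ ^ 2 ≤ (∫ t in x..y, ‖φ₁ t‖) ^ 2 :=
        pow_le_pow_left₀ (norm_nonneg _) (intervalIntegral.norm_integral_le_integral_norm hxy) 2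
    _ ≤ (y - x) * ∫ t in x..y, ‖φ₁ t‖ ^ 2 := sq_integral_le hφ₁.norm hxy
    _ ≤ (y - x) * l2inner ξ ξ := by
      refine mul_le_mul_of_nonneg_left ?_ (sub_nonneg.2 hxy)
      have : ∫ t in x..y, ‖φ₁ t‖ ^ 2 ≤ l2inner φ₁ φ₁ := by
        rw [l2inner_self]
        exact intervalIntegral.integral_mono_interval hx hxy hy
          (Filter.Eventually.of_forall fun t => sq_nonneg _) (hn.intervalIntegrable _ _)
      linarith [l2inner_self_nonneg φ]

lemma holder (h : IsHelmholtzSol φ ξ) {x y : ℝ} (hx : x ∈ Set.Icc 0 (2 * Real.pi))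
    (hy : y ∈ Set.Icc 0 (2 * Real.pi)) : ‖φ x - φ y‖ ^ 2 ≤ |x - y| * l2inner ξ ξ := by
  rcases le_total x y with hxy | hxy
  · rw [norm_sub_rev, abs_sub_comm, abs_of_nonneg (sub_nonneg.2 hxy)]
    exact h.holder_aux hx.1 hxy hy.2
  · rw [abs_of_nonneg (sub_nonneg.2 hxy)]
    exact h.holder_aux hy.1 hxy hx.2

lemma norm_sq_le (h : IsHelmholtzSol φ ξ) (x : ℝ) :
    ‖φ x‖ ^ 2 ≤ (4 * Real.pi + 1) * l2inner ξ ξ := by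
  obtain ⟨x', hx', hxx'⟩ := h.periodic.exists_mem_Ico₀ Real.two_pi_pos x
  rw [hxx']
  have hπ := Real.pi_gt_three
  have hφ := h.continuous
  obtain ⟨φ₁, h1, h2⟩ := h.exists_deriv
  have hen := h.energy h1 h2
  have h0 := l2inner_self_nonneg φ₁
  have hξ0 := l2inner_self_nonneg ξ
  have hpt : ∀ y ∈ Set.Icc 0 (2 * Real.pi),
      ‖φ x'‖ ^ 2 ≤ 2 * ‖φ y‖ ^ 2 + 4 * Real.pi * l2inner ξ ξ := fun y hy => by
    have h3 := norm_add_sq_le_two_mul (φ y) (φ x' - φ y)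
    rw [add_sub_cancel] at h3
    have h4 := h.holder (Set.Ico_subset_Icc_self hx') hy
    have h5 : |x' - y| ≤ 2 * Real.pi :=
      abs_le.2 ⟨by linarith [hx'.1, hy.2], by linarith [hx'.2, hy.1]⟩
    nlinarith [mul_le_mul_of_nonneg_right h5 hξ0]
  have hint : ∫ _y in (0 : ℝ)..(2 * Real.pi), ‖φ x'‖ ^ 2 ≤
      ∫ y in (0 : ℝ)..(2 * Real.pi), (2 * ‖φ y‖ ^ 2 + 4 * Real.pi * l2inner ξ ξ) :=
    intervalIntegral.integral_mono_on Real.two_pi_pos.le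
      (continuous_const.intervalIntegrable _ _)
      ((by fun_prop : Continuous fun y => 2 * ‖φ y‖ ^ 2 + 4 * Real.pi * l2inner ξ
        ξ).intervalIntegrable _ _) hpt
  rw [intervalIntegral.integral_add
    ((by fun_prop : Continuous fun y => 2 * ‖φ y‖ ^ 2).intervalIntegrable _ _)
    (continuous_const.intervalIntegrable _ _), intervalIntegral.integral_const_mul,
    ← l2inner_self φ, intervalIntegral.integral_const, intervalIntegral.integral_const,
    smul_eq_mul, smul_eq_mul, sub_zero] at hint
  have h6 : 2 * Real.pi * ‖φ x'‖ ^ 2 ≤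
      2 * Real.pi * ((4 * Real.pi + 1) * l2inner ξ ξ) := by
    nlinarith
  exact le_of_mul_le_mul_left h6 Real.two_pi_pos

end IsHelmholtzSol

namespace IsHelmholtzSol

variable {φ ξ ζ η : ℝ → ℂ}

lemma const_mul (h : IsHelmholtzSol φ ξ) (c : ℝ) :
    IsHelmholtzSol (fun x => c * φ x) (fun x => c * ξ x) := by
  obtain ⟨φ₁, h1, h2⟩ := h.exists_deriv
  exact ⟨fun x => by simp [h.periodic x], h.continuous_rhs.const_smul (c : ℂ),
    fun x => c * φ₁ x, fun x => (h1 x).const_mul _,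
    fun x => ((h2 x).const_mul _).congr_deriv (by ring)⟩

lemma l2inner_self_le (h : IsHelmholtzSol φ ξ) : l2inner φ φ ≤ l2inner ξ ξ := by
  obtain ⟨φ₁, h1, h2⟩ := h.exists_deriv
  linarith [h.energy h1 h2, l2inner_self_nonneg φ₁]

lemma deriv_deriv (h : IsHelmholtzSol φ ξ) (x : ℝ) : deriv (deriv φ) x = φ x - ξ x := by
  obtain ⟨φ₁, h1, h2⟩ := h.exists_deriv
  rw [show deriv φ = φ₁ from funext fun x => (h1 x).deriv]
  exact (h2 x).deriv

lemma contDiff (h : IsHelmholtzSol φ ξ) : ContDiff ℝ 2 φ := by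
  have hφ := h.continuous
  have hξ := h.continuous_rhs
  obtain ⟨φ₁, h1, h2⟩ := h.exists_deriv
  rw [show (2 : WithTop ℕ∞) = 1 + 1 by norm_num, contDiff_succ_iff_deriv,
    show deriv φ = φ₁ from funext fun x => (h1 x).deriv, contDiff_one_iff_deriv,
    show deriv φ₁ = fun x => φ x - ξ x from funext fun x => (h2 x).deriv]
  exact ⟨fun x => (h1 x).differentiableAt, by simp, fun x => (h2 x).differentiableAt,
    hφ.sub hξ⟩

/-- The solution operator is compact from `L²` to continuous functions. -/
lemma exists_subseq_tendstoUniformly {φ ξ : ℕ → ℝ → ℂ} {C : ℝ}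
    (h : ∀ n, IsHelmholtzSol (φ n) (ξ n)) (hC : ∀ n, l2inner (ξ n) (ξ n) ≤ C) :
    ∃ (Φ : ℝ → ℂ) (k : ℕ → ℕ), StrictMono k ∧ Continuous Φ ∧
      Function.Periodic Φ (2 * Real.pi) ∧
      TendstoUniformly (fun n => φ (k n)) Φ Filter.atTop := by
  have hC0 : 0 ≤ C := (l2inner_self_nonneg _).trans (hC 0)
  let F : ℕ → BoundedContinuousFunction (Set.Icc (0 : ℝ) (2 * Real.pi)) ℂ := fun n =>
    BoundedContinuousFunction.mkOfCompact ⟨fun x => φ n x, (h n).continuous.comp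
      continuous_subtype_val⟩
  have hcpt : IsCompact (closure (Set.range F)) := by
    refine BoundedContinuousFunction.arzela_ascoli
      (Metric.closedBall 0 (√((4 * Real.pi + 1) * C))) (isCompact_closedBall _ _) _ ?_ ?_
    · rintro _ x ⟨n, rfl⟩
      rw [mem_closedBall_zero_iff]
      refine Real.le_sqrt_of_sq_le (((h n).norm_sq_le x).trans ?_)
      exact mul_le_mul_of_nonneg_left (hC n) (by positivity)
    · refine Metric.equicontinuous_of_continuity_modulus (fun d => √(d * C)) ?_ _ ?_
      · have : Continuous fun d : ℝ => √(d * C) := by fun_prop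
        simpa using this.tendsto 0
      · rintro x y ⟨_, n, rfl⟩
        rw [dist_eq_norm]
        refine Real.le_sqrt_of_sq_le (((h n).holder x.2 y.2).trans ?_)
        exact mul_le_mul_of_nonneg_left (hC n) (abs_nonneg _)
  obtain ⟨g, -, k, hk, hlim⟩ := hcpt.tendsto_subseq
    fun n => subset_closure (Set.mem_range_self (f := F) n)
  have hrep : ∀ x : ℝ, ∃ y : Set.Icc (0 : ℝ) (2 * Real.pi), ∀ n, φ n x = φ n y := fun x =>
    ⟨⟨toIcoMod Real.two_pi_pos 0 x, by
      have := toIcoMod_mem_Ico Real.two_pi_pos 0 x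
      rw [zero_add] at this
      exact Set.Ico_subset_Icc_self this⟩, fun n =>
      ((h n).periodic.sub_zsmul_eq (toIcoDiv Real.two_pi_pos 0 x)).symm⟩
  choose rep hrep using hrep
  have hunif : TendstoUniformly (fun n => φ (k n)) (fun x => g (rep x)) Filter.atTop := by
    rw [Metric.tendstoUniformly_iff]
    intro ε hε
    filter_upwards [(Metric.tendsto_nhds.1 hlim) ε hε] with n hn x
    rw [hrep, dist_comm]
    exact (BoundedContinuousFunction.dist_coe_le_dist (f := F (k n)) (g := g) (rep x)).trans_lt hn
  refine ⟨_, k, hk, hunif.continuous (Filter.Frequently.of_forall fun n => (h _).continuous),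
    fun x => ?_, hunif⟩
  refine tendsto_nhds_unique (hunif.tendsto_at (x + 2 * Real.pi)) ?_
  simp only [(h _).periodic x]
  exact hunif.tendsto_at x

/-- The solution operator is continuous from `L²` to pointwise convergence. -/
lemma of_tendsto {φ ξ : ℕ → ℝ → ℂ} {Φ Ξ : ℝ → ℂ} (h : ∀ n, IsHelmholtzSol (φ n) (ξ n))
    (hΞ : Continuous Ξ) (hper : Function.Periodic Ξ (2 * Real.pi))
    (hφ : ∀ x, Filter.Tendsto (fun n => φ n x) Filter.atTop (nhds (Φ x)))
    (hξ : Filter.Tendsto (fun n => l2inner (fun y => ξ n y - Ξ y) (fun y => ξ n y - Ξ y))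
      Filter.atTop (nhds 0)) : IsHelmholtzSol Φ Ξ := by
  obtain ⟨ψ, hψ⟩ := exists_isHelmholtzSol hΞ hper
  suffices Φ = ψ from this ▸ hψ
  funext x
  refine tendsto_nhds_unique (hφ x) (tendsto_iff_norm_sub_tendsto_zero.2 ?_)
  have h1 : Filter.Tendsto (fun n => ‖φ n x - ψ x‖ ^ 2) Filter.atTop (nhds 0) := by
    refine squeeze_zero (fun _ => sq_nonneg _) (fun n => ((h n).sub hψ).norm_sq_le x) ?_
    simpa using hξ.const_mul (4 * Real.pi + 1)
  simpa [Real.sqrt_sq (norm_nonneg _)] using h1.sqrt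

end IsHelmholtzSol

lemma TendstoUniformly.l2inner_sub_tendsto {φ : ℕ → ℝ → ℂ} {Φ : ℝ → ℂ}
    (h : TendstoUniformly φ Φ Filter.atTop) (hφ : ∀ n, Continuous (φ n)) (hΦ : Continuous Φ) :
    Filter.Tendsto (fun n => l2inner (fun y => φ n y - Φ y) (fun y => φ n y - Φ y))
      Filter.atTop (nhds 0) := by
  rw [Metric.tendsto_nhds]
  intro ε hε
  set d := √(ε / (4 * Real.pi)) with hd
  have hπ := Real.pi_pos
  have hd0 : 0 < d := Real.sqrt_pos.2 (by positivity)
  filter_upwards [Metric.tendstoUniformly_iff.1 h d hd0] with n hn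
  rw [Real.dist_eq, sub_zero, abs_of_nonneg (l2inner_self_nonneg _)]
  refine (l2inner_self_le_const ((hφ n).sub hΦ) (C := d ^ 2) fun y => ?_).trans_lt ?_
  · have := hn y
    rw [dist_comm, dist_eq_norm] at this
    exact pow_le_pow_left₀ (norm_nonneg _) this.le 2
  · rw [hd, Real.sq_sqrt (by positivity)]
    field_simp
    linarith

/-- The function `-φ'' + iuφ`, for a solution `φ` of `φ - φ'' = ξ`. -/
noncomputable def hamiltonian (u : ℝ → ℝ) (φ ξ : ℝ → ℂ) : ℝ → ℂ :=
  fun y => ξ y - φ y + Complex.I * u y * φ y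

lemma IsHelmholtzSol.continuous_hamiltonian {u : ℝ → ℝ} {φ ξ : ℝ → ℂ} (hu : Continuous u)
    (h : IsHelmholtzSol φ ξ) : Continuous (hamiltonian u φ ξ) := by
  have := h.continuous
  have := h.continuous_rhs
  unfold hamiltonian
  fun_prop

lemma Psi0_nonneg (u : ℝ → ℝ) : 0 ≤ Psi0 u := by
  refine Real.sInf_nonneg ?_
  rintro _ ⟨f, -, -, -, rfl⟩
  exact Real.sqrt_nonneg _

lemma IsHelmholtzSol.Psi0_sq_mul_le {u : ℝ → ℝ} {φ ξ : ℝ → ℂ} (h : IsHelmholtzSol φ ξ) :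
    Psi0 u ^ 2 * l2inner φ φ ≤ l2inner (hamiltonian u φ ξ) (hamiltonian u φ ξ) := by
  rcases (l2inner_self_nonneg φ).eq_or_lt with h0 | h0
  · rw [← h0, mul_zero]
    exact l2inner_self_nonneg _
  set c := (√(l2inner φ φ))⁻¹ with hc
  have hc0 : 0 ≤ c := inv_nonneg.2 (Real.sqrt_nonneg _)
  have hc2 : c ^ 2 * l2inner φ φ = 1 := by
    rw [hc, inv_pow, Real.sq_sqrt h0.le, inv_mul_cancel₀ h0.ne']
  have hcφ := h.const_mul c
  have hle : Psi0 u ≤ c * √(l2inner (hamiltonian u φ ξ) (hamiltonian u φ ξ)) := by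
    refine csInf_le ⟨0, ?_⟩ ⟨fun x => c * φ x, hcφ.contDiff, hcφ.periodic, ?_, ?_⟩
    · rintro _ ⟨f, -, -, -, rfl⟩
      exact Real.sqrt_nonneg _
    · rw [l2norm_eq_sqrt, l2inner_smul_left, l2inner_smul_right, ← mul_assoc, ← sq, hc2,
        Real.sqrt_one]
    · have : (fun y => -(deriv (deriv fun x => (c : ℂ) * φ x)) y +
          Complex.I * (u y : ℂ) * (c * φ y)) = fun y => (c : ℂ) * hamiltonian u φ ξ y := by
        funext y
        rw [hcφ.deriv_deriv, hamiltonian]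
        ring
      rw [this, l2norm_eq_sqrt, l2inner_smul_left, l2inner_smul_right, ← mul_assoc, ← sq,
        Real.sqrt_mul (sq_nonneg c), Real.sqrt_sq hc0]
  have := pow_le_pow_left₀ (Psi0_nonneg u) hle 2
  rw [mul_pow, Real.sq_sqrt (l2inner_self_nonneg _)] at this
  calc Psi0 u ^ 2 * l2inner φ φ ≤ _ := mul_le_mul_of_nonneg_right this h0.le
    _ = (c ^ 2 * l2inner φ φ) * l2inner (hamiltonian u φ ξ) (hamiltonian u φ ξ) := by ring
    _ = _ := by rw [hc2, one_mul]

lemma l2inner_sub_smul_self {f g : ℝ → ℂ} (hf : Continuous f) (hg : Continuous g) (t : ℝ) :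
    l2inner (fun y => f y - t * g y) (fun y => f y - t * g y) =
      l2inner f f - 2 * t * l2inner f g + t ^ 2 * l2inner g g := by
  have htg : Continuous fun y => (t : ℂ) * g y := by fun_prop
  have hfg : Continuous fun y => f y - (t : ℂ) * g y := by fun_prop
  rw [l2inner_sub_left hf htg hfg, l2inner_sub_right hf htg hf, l2inner_sub_right hf htg htg,
    l2inner_smul_left, l2inner_smul_left, l2inner_smul_right, l2inner_smul_right,
    l2inner_comm g f]
  ring

/-- Cauchy-Schwarz for the nonnegative quadratic form `‖Hφ‖² - Ψ₀² ‖φ‖²`. -/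
lemma IsHelmholtzSol.sq_le_mul {u : ℝ → ℝ} {f ξ φ ζ : ℝ → ℂ} (hu : Continuous u)
    (h : IsHelmholtzSol f ξ) (h' : IsHelmholtzSol φ ζ) :
    (l2inner (hamiltonian u f ξ) (hamiltonian u φ ζ) - Psi0 u ^ 2 * l2inner f φ) ^ 2 ≤
      (l2inner (hamiltonian u f ξ) (hamiltonian u f ξ) - Psi0 u ^ 2 * l2inner f f) *
      (l2inner (hamiltonian u φ ζ) (hamiltonian u φ ζ) - Psi0 u ^ 2 * l2inner φ φ) := by
  have hquad : ∀ t : ℝ, 0 ≤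
      (l2inner (hamiltonian u φ ζ) (hamiltonian u φ ζ) - Psi0 u ^ 2 * l2inner φ φ) * (t * t) +
      (-2 * (l2inner (hamiltonian u f ξ) (hamiltonian u φ ζ) - Psi0 u ^ 2 * l2inner f φ)) * t +
      (l2inner (hamiltonian u f ξ) (hamiltonian u f ξ) - Psi0 u ^ 2 * l2inner f f) := fun t => by
    have h1 := (h.sub (h'.const_mul t)).Psi0_sq_mul_le (u := u)
    have h2 : hamiltonian u (fun x => f x - t * φ x) (fun x => ξ x - t * ζ x) =
        fun y => hamiltonian u f ξ y - t * hamiltonian u φ ζ y := by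
      funext y
      simp only [hamiltonian]
      ring
    rw [h2, l2inner_sub_smul_self h.continuous h'.continuous,
      l2inner_sub_smul_self (h.continuous_hamiltonian hu) (h'.continuous_hamiltonian hu)] at h1
    linarith
  have := discrim_le_zero hquad
  rw [discrim] at this
  linarith

lemma norm_one_add_I_mul_sq_le {U v : ℝ} (h : |v| ≤ U) (w z : ℂ) (hw : ‖w‖ = 1) :
    ‖z + w * (v * z)‖ ^ 2 ≤ (1 + U) ^ 2 * ‖z‖ ^ 2 := by
  rw [← mul_pow]
  refine pow_le_pow_left₀ (norm_nonneg _) ((norm_add_le _ _).trans ?_) 2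
  rw [norm_mul, norm_mul, hw, Complex.norm_real, Real.norm_eq_abs]
  nlinarith [mul_le_mul_of_nonneg_right h (norm_nonneg z)]

/-- For an almost minimizer `f`, the function `Hf` almost solves the Euler-Lagrange equation. -/
lemma IsHelmholtzSol.residual_le {u : ℝ → ℝ} {U : ℝ} {f ξ G : ℝ → ℂ} (hu : Continuous u)
    (hU : ∀ y, |u y| ≤ U) (h : IsHelmholtzSol f ξ)
    (hper : Function.Periodic (hamiltonian u f ξ) (2 * Real.pi))
    (hG : IsHelmholtzSol G fun y => (Psi0 u ^ 2 : ℝ) * f y +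
      (hamiltonian u f ξ y + Complex.I * (u y * hamiltonian u f ξ y))) :
    l2inner (fun y => hamiltonian u f ξ y - G y) (fun y => hamiltonian u f ξ y - G y) ≤
      (2 + 2 * (1 + U) ^ 2) *
        (l2inner (hamiltonian u f ξ) (hamiltonian u f ξ) - Psi0 u ^ 2 * l2inner f f) := by
  set p := hamiltonian u f ξ with hp
  have hf := h.continuous
  have hpc : Continuous p := h.continuous_hamiltonian hu
  have hGc := hG.continuous
  have hrc : Continuous fun y => p y - G y := hpc.sub hGc
  obtain ⟨φ, hφ⟩ := exists_isHelmholtzSol hrc fun x => by simp only [hper x, hG.periodic x]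
  set r : ℝ → ℂ := fun y => p y - G y with hr
  have hφc := hφ.continuous
  set k := hamiltonian u φ r with hk
  have hkc : Continuous k := hφ.continuous_hamiltonian hu
  have hcs := h.sq_le_mul hu hφ
  have hkr : l2inner k k ≤ (2 + 2 * (1 + U) ^ 2) * l2inner r r := by
    have hqc : Continuous fun y => φ y + -Complex.I * (u y * φ y) := by fun_prop
    have e1 : k = fun y => r y + -(1 : ℝ) * (φ y + -Complex.I * (u y * φ y)) := by
      funext y
      simp only [hk, hamiltonian]
      push_cast
      ring
    have e2 := l2inner_add_self_le hrc
      (by fun_prop : Continuous fun y => -((1 : ℝ) : ℂ) * (φ y + -Complex.I * (u y * φ y)))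
    have e3 : l2inner (fun y => -((1 : ℝ) : ℂ) * (φ y + -Complex.I * (u y * φ y)))
        (fun y => -((1 : ℝ) : ℂ) * (φ y + -Complex.I * (u y * φ y))) ≤
        (1 + U) ^ 2 * l2inner φ φ :=
      l2inner_self_mono (by fun_prop) hφc fun y => by
        rw [norm_mul]
        simpa using norm_one_add_I_mul_sq_le (hU y) (-Complex.I) (φ y) (by simp)
    have e4 := mul_le_mul_of_nonneg_left hφ.l2inner_self_le (sq_nonneg (1 + U))
    rw [e1]
    linarith
  have hid : l2inner r r = l2inner p k - Psi0 u ^ 2 * l2inner f φ := by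
    have hIuφ : Continuous fun y => Complex.I * u y * φ y := by fun_prop
    have hIup : Continuous fun y => Complex.I * (u y * p y) := by fun_prop
    have hrφ : Continuous fun y => r y - φ y := hrc.sub hφc
    have e1 : l2inner p k = l2inner p r - l2inner p φ +
        l2inner p (fun y => Complex.I * u y * φ y) := by
      rw [← l2inner_sub_right hrc hφc hpc, ← l2inner_add_right hrφ hIuφ hpc]
      rfl
    have e2 : l2inner p (fun y => Complex.I * u y * φ y) =
        -l2inner (fun y => Complex.I * (u y * p y)) φ := by
      simp only [l2inner]
      rw [← intervalIntegral.integral_neg]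
      congr 1
      funext y
      simp only [Complex.inner, Complex.mul_re, Complex.conj_re, Complex.conj_im, Complex.mul_im,
        Complex.I_re, Complex.I_im, Complex.ofReal_re, Complex.ofReal_im]
      ring
    have e3 := hG.l2inner_symm hφ
    have hlf : Continuous fun y => ((Psi0 u ^ 2 : ℝ) : ℂ) * f y := by fun_prop
    have hpp : Continuous fun y => p y + Complex.I * (u y * p y) := by fun_prop
    rw [l2inner_add_left hlf hpp hφc, l2inner_smul_left, l2inner_add_left hpc hIup hφc] at e3
    have e4 : l2inner r r = l2inner p r - l2inner G r := l2inner_sub_left hpc hGc hrc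
    linarith
  rw [← hp, ← hk, ← hid] at hcs
  have hQ := h.Psi0_sq_mul_le (u := u)
  rw [← hp] at hQ
  have hrr := l2inner_self_nonneg r
  have hφφ := mul_nonneg (sq_nonneg (Psi0 u)) (l2inner_self_nonneg φ)
  rcases hrr.eq_or_lt with h0 | h0
  · rw [← h0]
    exact mul_nonneg (by positivity) (sub_nonneg.2 hQ)
  · refine le_of_mul_le_mul_right ?_ h0
    have := mul_le_mul_of_nonneg_left (show l2inner k k - Psi0 u ^ 2 * l2inner φ φ ≤
      (2 + 2 * (1 + U) ^ 2) * l2inner r r by linarith) (sub_nonneg.2 hQ)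
    nlinarith

lemma tendsto_l2inner_add_self {a b : ℕ → ℝ → ℂ} (ha : ∀ n, Continuous (a n))
    (hb : ∀ n, Continuous (b n))
    (ha0 : Filter.Tendsto (fun n => l2inner (a n) (a n)) Filter.atTop (nhds 0))
    (hb0 : Filter.Tendsto (fun n => l2inner (b n) (b n)) Filter.atTop (nhds 0)) :
    Filter.Tendsto (fun n => l2inner (fun y => a n y + b n y) (fun y => a n y + b n y))
      Filter.atTop (nhds 0) := by
  refine squeeze_zero (fun _ => l2inner_self_nonneg _)
    (fun n => l2inner_add_self_le (ha n) (hb n)) ?_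
  simpa using (ha0.const_mul 2).add (hb0.const_mul 2)

lemma tendsto_l2inner_one_add_mul {u : ℝ → ℝ} {U : ℝ} (hu : Continuous u)
    (hU : ∀ y, |u y| ≤ U) {w : ℂ} (hw : ‖w‖ = 1) {a : ℕ → ℝ → ℂ} (ha : ∀ n, Continuous (a n))
    (ha0 : Filter.Tendsto (fun n => l2inner (a n) (a n)) Filter.atTop (nhds 0)) :
    Filter.Tendsto (fun n => l2inner (fun y => a n y + w * (u y * a n y))
      (fun y => a n y + w * (u y * a n y))) Filter.atTop (nhds 0) := by
  refine squeeze_zero (fun _ => l2inner_self_nonneg _) (fun n => l2inner_self_mono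
    (by have := ha n; fun_prop) (ha n) fun y => norm_one_add_I_mul_sq_le (hU y) w _ hw) ?_
  simpa using ha0.const_mul ((1 + U) ^ 2)

lemma exists_almost_minimizer {u : ℝ → ℝ}
    (huper : Function.Periodic u (2 * Real.pi)) {ε : ℝ} (hε : 0 < ε) :
    ∃ f ξ : ℝ → ℂ, IsHelmholtzSol f ξ ∧
      Function.Periodic (hamiltonian u f ξ) (2 * Real.pi) ∧ l2inner f f = 1 ∧
      l2inner (hamiltonian u f ξ) (hamiltonian u f ξ) ≤ (Psi0 u + ε) ^ 2 := by
  have hne : {r : ℝ | ∃ f : ℝ → ℂ, ContDiff ℝ 2 f ∧ Function.Periodic f (2 * Real.pi) ∧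
      l2norm f = 1 ∧
      r = l2norm fun y => -(deriv (deriv f)) y + Complex.I * (u y : ℂ) * f y}.Nonempty := by
    refine ⟨_, fun _ => ((√(2 * Real.pi))⁻¹ : ℝ), contDiff_const, fun _ => rfl, ?_, rfl⟩
    have hπ := Real.pi_pos
    have h2 : (√(2 * Real.pi)) ^ 2 = 2 * Real.pi := Real.sq_sqrt (by positivity)
    rw [l2norm, Real.sqrt_eq_one, intervalIntegral.integral_const, Complex.norm_real,
      Real.norm_eq_abs, sq_abs, inv_pow, h2, sub_zero, smul_eq_mul,
      mul_inv_cancel₀ (by positivity)]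
  obtain ⟨_, ⟨f, hf, hfper, hf1, rfl⟩, hlt⟩ :=
    exists_lt_of_csInf_lt hne (lt_add_of_pos_right (Psi0 u) hε)
  have hd1 : ∀ x, HasDerivAt f (deriv f x) x := fun x =>
    (hf.differentiable (by norm_num) x).hasDerivAt
  have hf' : ContDiff ℝ 1 (deriv f) := by
    rw [show (2 : WithTop ℕ∞) = 1 + 1 by norm_num, contDiff_succ_iff_deriv] at hf
    exact hf.2.2
  have hd2 : ∀ x, HasDerivAt (deriv f) (deriv (deriv f) x) x := fun x =>
    (hf'.differentiable (by norm_num) x).hasDerivAt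
  have hp2 : Function.Periodic (deriv (deriv f)) (2 * Real.pi) :=
    (hfper.of_hasDerivAt hd1).of_hasDerivAt hd2
  have hfc : Continuous f := hf.continuous
  have hf2c : Continuous (deriv (deriv f)) := hf'.continuous_deriv_one
  have hH : (fun y => -(deriv (deriv f)) y + Complex.I * (u y : ℂ) * f y) =
      hamiltonian u f fun y => f y - deriv (deriv f) y := by
    funext y
    simp only [hamiltonian]
    ring
  refine ⟨f, fun y => f y - deriv (deriv f) y, ⟨hfper, hfc.sub hf2c, _, hd1, fun x => ?_⟩,
    ?_, ?_, ?_⟩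
  · simpa using hd2 x
  · rw [← hH]
    intro x
    simp only [hp2 x, huper x, hfper x]
  · rwa [l2norm_eq_sqrt, Real.sqrt_eq_one] at hf1
  · rw [hH, l2norm_eq_sqrt] at hlt
    exact (Real.sqrt_le_left (add_nonneg (Psi0_nonneg u) hε.le)).1 hlt.le

lemma exists_abs_le_of_periodic {u : ℝ → ℝ} (hu : Continuous u)
    (huper : Function.Periodic u (2 * Real.pi)) : ∃ U, ∀ y, |u y| ≤ U := by
  obtain ⟨U, hU⟩ := isCompact_Icc.exists_bound_of_continuousOn
    (hu.continuousOn (s := Set.Icc 0 (2 * Real.pi)))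
  refine ⟨U, fun y => ?_⟩
  obtain ⟨z, hz, h⟩ := huper.exists_mem_Ico₀ Real.two_pi_pos y
  rw [h]
  exact hU z (Set.Ico_subset_Icc_self hz)

/-- The infimum `Ψ₀` is attained; the extremizer satisfies the Euler-Lagrange system. -/
lemma exists_extremizer {u : ℝ → ℝ} (hu : Continuous u)
    (huper : Function.Periodic u (2 * Real.pi)) :
    ∃ f G : ℝ → ℂ, IsHelmholtzSol f (fun y => G y + (f y + -Complex.I * (u y * f y))) ∧
      IsHelmholtzSol G
        (fun y => (Psi0 u ^ 2 : ℝ) * f y + (G y + Complex.I * (u y * G y))) ∧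
      0 < l2inner f f := by
  obtain ⟨U, hU⟩ := exists_abs_le_of_periodic hu huper
  set L := Psi0 u with hL
  have hL0 : 0 ≤ L := Psi0_nonneg u
  have hε : ∀ n : ℕ, (0 : ℝ) < 1 / (n + 1) := fun n => by positivity
  choose f ξ hf hHper hf1 hHle using fun n => exists_almost_minimizer huper (hε n)
  set H : ℕ → ℝ → ℂ := fun n => hamiltonian u (f n) (ξ n) with hH
  have hfc := fun n => (hf n).continuous
  have hHc : ∀ n, Continuous (H n) := fun n => (hf n).continuous_hamiltonian hu
  have hex : ∀ n, ∃ G, IsHelmholtzSol G fun y => (L ^ 2 : ℝ) * f n y +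
      (H n y + Complex.I * (u y * H n y)) := fun n => by
    have := hfc n
    have := hHc n
    refine exists_isHelmholtzSol (by fun_prop) fun x => ?_
    have h1 : H n (x + 2 * Real.pi) = H n x := hHper n x
    simp only [h1, (hf n).periodic x, huper x]
  choose G hG using hex
  have hGc := fun n => (hG n).continuous
  have hres : ∀ n, l2inner (fun y => H n y - G n y) (fun y => H n y - G n y) ≤
      (2 + 2 * (1 + U) ^ 2) * ((L + 1 / (n + 1)) ^ 2 - L ^ 2) := fun n => by
    have := (hf n).residual_le hu hU (hHper n) (hG n)
    rw [hf1 n, mul_one] at this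
    exact this.trans (mul_le_mul_of_nonneg_left (sub_le_sub_right (hHle n) _) (by positivity))
  have hres0 : Filter.Tendsto (fun n => l2inner (fun y => H n y - G n y)
      (fun y => H n y - G n y)) Filter.atTop (nhds 0) := by
    refine squeeze_zero (fun _ => l2inner_self_nonneg _) hres ?_
    have := (((tendsto_one_div_add_atTop_nhds_zero_nat (𝕜 := ℝ)).const_add L).pow 2).sub_const
      (L ^ 2)
    simpa using this.const_mul (2 + 2 * (1 + U) ^ 2)
  have hHb : ∀ n, l2inner (H n) (H n) ≤ (L + 1) ^ 2 := fun n =>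
    (hHle n).trans (pow_le_pow_left₀ (by have := hε n; positivity) (by
      have : (1 : ℝ) / (n + 1) ≤ 1 := by
        rw [div_le_one (by positivity)]
        linarith [n.cast_nonneg (α := ℝ)]
      linarith) 2)
  have hIf : ∀ n, Continuous fun y => f n y + -Complex.I * (u y * f n y) := fun n => by
    have := hfc n
    fun_prop
  have hIH : ∀ n, Continuous fun y => H n y + Complex.I * (u y * H n y) := fun n => by
    have := hHc n
    fun_prop
  have hξ : ∀ n, ξ n = fun y => H n y + (f n y + -Complex.I * (u y * f n y)) := fun n => by
    funext y
    simp only [hH, hamiltonian]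
    ring
  have hξb : ∀ n, l2inner (ξ n) (ξ n) ≤ 2 * (L + 1) ^ 2 + 2 * (1 + U) ^ 2 := fun n => by
    rw [hξ n]
    have h1 := l2inner_add_self_le (hHc n) (hIf n)
    have h2 := l2inner_self_mono (hIf n) (hfc n) fun y =>
      norm_one_add_I_mul_sq_le (hU y) (-Complex.I) (f n y) (by simp)
    rw [hf1 n] at h2
    linarith [hHb n]
  have hLf : ∀ n, Continuous fun y => ((L ^ 2 : ℝ) : ℂ) * f n y := fun n => by
    have := hfc n
    fun_prop
  have hηb : ∀ n, l2inner (fun y => (L ^ 2 : ℝ) * f n y + (H n y + Complex.I * (u y * H n y)))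
      (fun y => (L ^ 2 : ℝ) * f n y + (H n y + Complex.I * (u y * H n y))) ≤
      2 * (L ^ 2 * L ^ 2) + 2 * ((1 + U) ^ 2 * (L + 1) ^ 2) := fun n => by
    have h1 := l2inner_add_self_le (hLf n) (hIH n)
    have h2 := l2inner_self_mono (hIH n) (hHc n) fun y =>
      norm_one_add_I_mul_sq_le (hU y) Complex.I (H n y) (by simp)
    have h3 := mul_le_mul_of_nonneg_left (hHb n) (sq_nonneg (1 + U))
    rw [l2inner_smul_left, l2inner_smul_right, hf1 n, mul_one] at h1
    linarith
  obtain ⟨Φ, k₁, hk₁, hΦc, hΦper, hΦ⟩ :=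
    IsHelmholtzSol.exists_subseq_tendstoUniformly hf hξb
  obtain ⟨Γ, k₂, hk₂, hΓc, hΓper, hΓ⟩ :=
    IsHelmholtzSol.exists_subseq_tendstoUniformly (fun n => hG (k₁ n)) fun n => hηb (k₁ n)
  set k := fun n => k₁ (k₂ n) with hk
  have hkt : Filter.Tendsto k Filter.atTop Filter.atTop :=
    hk₁.tendsto_atTop.comp hk₂.tendsto_atTop
  have hΦ' : TendstoUniformly (fun n => f (k n)) Φ Filter.atTop := fun v hv =>
    hk₂.tendsto_atTop.eventually (hΦ v hv)
  have hfL := hΦ'.l2inner_sub_tendsto (fun n => hfc _) hΦc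
  have hGL := hΓ.l2inner_sub_tendsto (fun n => hGc _) hΓc
  have hHL : Filter.Tendsto (fun n => l2inner (fun y => H (k n) y - Γ y)
      (fun y => H (k n) y - Γ y)) Filter.atTop (nhds 0) := by
    simpa using tendsto_l2inner_add_self (fun n => (hHc (k n)).sub (hGc (k n)))
      (fun n => (hGc (k n)).sub hΓc) (hres0.comp hkt) hGL
  have hfd : ∀ n, Continuous fun y => f (k n) y - Φ y := fun n => (hfc _).sub hΦc
  have hHd : ∀ n, Continuous fun y => H (k n) y - Γ y := fun n => (hHc _).sub hΓc
  have hIfd : ∀ n, Continuous fun y =>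
      (f (k n) y - Φ y) + -Complex.I * (u y * (f (k n) y - Φ y)) := fun n => by
    have := hfd n
    fun_prop
  have hIHd : ∀ n, Continuous fun y =>
      (H (k n) y - Γ y) + Complex.I * (u y * (H (k n) y - Γ y)) := fun n => by
    have := hHd n
    fun_prop
  refine ⟨Φ, Γ, ?_, ?_, ?_⟩
  · refine IsHelmholtzSol.of_tendsto (fun n => hf (k n)) (by fun_prop)
      (fun x => by simp only [hΦper x, hΓper x, huper x]) (fun x => hΦ'.tendsto_at x) ?_
    convert tendsto_l2inner_add_self hHd hIfd hHL
      (tendsto_l2inner_one_add_mul hu hU (by simp) hfd hfL) using 3 with n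
    all_goals
      funext y
      rw [hξ]
      ring
  · refine IsHelmholtzSol.of_tendsto (fun n => hG (k n)) (by fun_prop)
      (fun x => by simp only [hΦper x, hΓper x, huper x]) (fun x => hΓ.tendsto_at x) ?_
    have hLfd : ∀ n, Continuous fun y => ((L ^ 2 : ℝ) : ℂ) * (f (k n) y - Φ y) := fun n => by
      have := hfd n
      fun_prop
    have hLd : Filter.Tendsto (fun n => l2inner (fun y => ((L ^ 2 : ℝ) : ℂ) * (f (k n) y - Φ y))
        (fun y => ((L ^ 2 : ℝ) : ℂ) * (f (k n) y - Φ y))) Filter.atTop (nhds 0) := by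
      simp only [l2inner_smul_left, l2inner_smul_right]
      simpa using (hfL.const_mul (L ^ 2)).const_mul (L ^ 2)
    convert tendsto_l2inner_add_self hLfd hIHd hLd
      (tendsto_l2inner_one_add_mul hu hU (by simp) hHd hHL) using 3 with n
    all_goals
      funext y
      ring
  · have h1 : ∀ n, 1 ≤ 2 * l2inner (fun y => f (k n) y - Φ y) (fun y => f (k n) y - Φ y) +
        2 * l2inner Φ Φ := fun n => by
      have := l2inner_add_self_le (hfd n) hΦc
      simpa [hf1] using this
    have h2 := ge_of_tendsto' ((hfL.const_mul 2).add_const (2 * l2inner Φ Φ)) h1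
    linarith

lemma exists_forall_le_of_periodic {R : ℝ → ℝ} (hR : Continuous R)
    (hper : Function.Periodic R (2 * Real.pi)) : ∃ a, ∀ t, R t ≤ R a := by
  obtain ⟨a, -, ha⟩ := isCompact_Icc.exists_isMaxOn
    (Set.nonempty_Icc.2 Real.two_pi_pos.le) (hR.continuousOn (s := Set.Icc 0 (2 * Real.pi)))
  refine ⟨a, fun t => ?_⟩
  obtain ⟨t', ht', h⟩ := hper.exists_mem_Ico₀ Real.two_pi_pos t
  rw [h]
  exact ha (Set.Ico_subset_Icc_self ht')

lemma bddBelow_omega0 {δ : ℝ} (hδ : 0 ≤ δ) (ψ : ℝ → ℝ) :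
    BddBelow {r : ℝ | ∃ x c : ℝ, r = ∫ y in (x - δ)..(x + δ), (ψ y - c) ^ 2} := by
  refine ⟨0, ?_⟩
  rintro _ ⟨x, c, rfl⟩
  exact intervalIntegral.integral_nonneg (by linarith) fun _ _ => sq_nonneg _

lemma omega1_le_omega0 {δ : ℝ} (hδ : 0 ≤ δ) (ψ : ℝ → ℝ) (lam : ℝ) :
    omega1 δ ψ ≤ omega0 δ fun y => ψ y - lam * y := by
  refine csInf_le_csInf ⟨0, ?_⟩ ⟨_, 0, 0, rfl⟩ ?_
  · rintro _ ⟨x, c₁, c₂, rfl⟩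
    exact intervalIntegral.integral_nonneg (by linarith) fun _ _ => sq_nonneg _
  · rintro _ ⟨x, c, rfl⟩
    exact ⟨x, c, lam, by simp only [sub_right_comm]⟩

lemma mul_tan_lt_mul_tan {x y : ℝ} (hx : 0 < x) (hxy : x < y) (hy : y < Real.pi / 2) :
    x * Real.tan x < y * Real.tan y :=
  mul_lt_mul'' hxy (Real.tan_lt_tan_of_nonneg_of_lt_pi_div_two hx.le hy hxy) hx.le
    (Real.tan_pos_of_pos_of_lt_pi_div_two hx (hxy.trans hy)).le

lemma le_Psi0_of_le_omega0 {u ψ : ℝ → ℝ} (hu : Continuous u)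
    (huper : Function.Periodic u (2 * Real.pi)) (hψ : ∀ y, HasDerivAt ψ (u y) y)
    {δ s : ℝ} (hδ : 0 < δ) (hs : 0 ≤ s) (hs2 : s < Real.pi / 2)
    (h : 36 * s * Real.tan s ≤ δ * omega0 δ ψ) : (s / δ) ^ 2 ≤ Psi0 u := by
  by_contra! hlt
  obtain ⟨f, G, hf, hG, hff⟩ := exists_extremizer hu huper
  have hL0 := Psi0_nonneg u
  obtain ⟨l, hLl, hls⟩ := exists_between hlt
  set L := Psi0 u with hL
  have hl0 : 0 < l := hL0.trans_lt hLl
  set μ := √((l + L ^ 2 / l) / 2) with hμ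
  have hν0 : 0 < (l + L ^ 2 / l) / 2 := by positivity
  have hνl : (l + L ^ 2 / l) / 2 ≤ l := by
    have : L ^ 2 / l ≤ l := by
      rw [div_le_iff₀ hl0]
      nlinarith
    linarith
  have hμ0 : 0 < μ := Real.sqrt_pos.2 hν0
  have hμ2 : μ ^ 2 = (l + L ^ 2 / l) / 2 := Real.sq_sqrt hν0.le
  have hμs : μ * δ < s := by
    rw [← lt_div_iff₀ hδ]
    exact lt_of_pow_lt_pow_left₀ 2 (by positivity) (by rw [hμ2]; linarith)
  have hlC : (l : ℂ) ≠ 0 := by exact_mod_cast hl0.ne'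
  obtain ⟨f₁, hf1, hf2⟩ := hf.exists_deriv
  obtain ⟨G₁, hG1, hG2⟩ := hG.exists_deriv
  set g : ℝ → ℂ := fun t => G t / l with hg
  have hfc := hf.continuous
  have hGc := hG.continuous
  obtain ⟨a, ha⟩ := exists_forall_le_of_periodic
    (R := fun t => Complex.normSq (f t) + Complex.normSq (g t))
    ((Complex.continuous_normSq.comp hfc).add
      (Complex.continuous_normSq.comp (hGc.div_const _)))
    fun t => by simp only [hg, hf.periodic t, hG.periodic t]
  have hpos : 0 < Complex.normSq (f a) + Complex.normSq (g a) := by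
    by_contra! hle
    have := l2inner_self_le_const hfc (C := 0) fun y => by
      rw [← Complex.normSq_eq_norm_sq]
      linarith [ha y, Complex.normSq_nonneg (g y)]
    linarith
  obtain ⟨c, hc⟩ := exists_integral_sq_le_of_system (f := f) (f₁ := f₁) (g := g)
    (g₁ := fun t => G₁ t / l) (α := l) (β := L ^ 2 / l) (a := a) hμ0 (by rw [hμ2]; ring) hδ.le
    (hμs.trans hs2) hψ hf1 (fun t => (hf2 t).congr_deriv (by simp only [hg]; field_simp; ring))
    (fun t => (hG1 t).div_const _)
    (fun t => ((hG2 t).div_const _).congr_deriv (by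
      simp only [hg]; push_cast; field_simp; ring)) ha hpos
  have h1 : omega0 δ ψ ≤ 36 * (μ * Real.tan (μ * δ)) :=
    (csInf_le (bddBelow_omega0 hδ.le ψ) ⟨a, c, rfl⟩).trans hc
  have h2 := mul_le_mul_of_nonneg_left h1 hδ.le
  have h3 := mul_tan_lt_mul_tan (mul_pos hμ0 hδ) hμs hs2
  linarith

/-- Lower bounds `Ψ₀(u) ≥ (φ⁻¹(δω₀(δ,u))/δ)²` and `Ψ₁(u) ≥ (φ⁻¹(δω₁(δ,u))/δ)²`
for `φ(s) = 36 s tan s`, stated as: for every `s ∈ [0, π/2)` with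
`36 s tan s ≤ δ ω₀(δ,u)` one has `Ψ₀(u) ≥ (s/δ)²`, and likewise for `ω₁, Ψ₁`. -/
theorem stmt_11 (u : ℝ → ℝ) (hu : Continuous u) (huper : Function.Periodic u (2 * Real.pi))
    (ψ : ℝ → ℝ) (hψ : ∀ y, HasDerivAt ψ (u y) y) :
    ∀ δ : ℝ, 0 < δ → ∀ s : ℝ, 0 ≤ s → s < Real.pi / 2 →
      (36 * s * Real.tan s ≤ δ * omega0 δ ψ → (s / δ) ^ 2 ≤ Psi0 u) ∧
      (36 * s * Real.tan s ≤ δ * omega1 δ ψ → (s / δ) ^ 2 ≤ Psi1 u) := by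
  intro δ hδ s hs hs2
  refine ⟨le_Psi0_of_le_omega0 hu huper hψ hδ hs hs2, fun h => le_csInf ⟨_, 0, rfl⟩ ?_⟩
  rintro _ ⟨lam, rfl⟩
  refine le_Psi0_of_le_omega0 (ψ := fun y => ψ y - lam * y) (by fun_prop)
    (fun x => by simp only [huper x]) (fun y => ?_) hδ hs hs2
    (h.trans (mul_le_mul_of_nonneg_left (omega1_le_omega0 hδ.le ψ lam) hδ.le))
  exact ((hψ y).sub ((hasDerivAt_id y).const_mul lam)).congr_deriv (by simp)
end
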